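/- arXiv:1208.6507 — 2 statements merged into one kernel-verified Lean document; each statement's English description precedes it below -/
import Mathlib

section
/- (Cauchy-type formula in the plane) For every convex body K in ℝ², the perimeter of K equals the integral of its support function over the unit circle: H^1(∂K) = ∫_{S^1} h_K dH^1, where ∂K is the topological boundary of K and H^1 is the 1-dimensional Hausdorff measure. -/
open MeasureTheory RealInnerProductSpace

/-- The support function of a set `K ⊆ ℝ²`. -/
noncomputable def suppFn (K : Set (EuclideanSpace ℝ (Fin 2)))
    (u : EuclideanSpace ℝ (Fin 2)) : ℝ :=
  sSup ((fun x => ⟪x, u⟫) '' K)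

namespace CauchyPerim

abbrev E := EuclideanSpace ℝ (Fin 2)

noncomputable def ee (θ : ℝ) : E := !₂[Real.cos θ, Real.sin θ]

lemma inner_ee (x : E) (θ : ℝ) : ⟪x, ee θ⟫ = x 0 * Real.cos θ + x 1 * Real.sin θ := by
  simp [ee, PiLp.inner_apply, Fin.sum_univ_two, mul_comm]

lemma norm_ee (θ : ℝ) : ‖ee θ‖ = 1 := by
  simp [ee, EuclideanSpace.norm_eq, Fin.sum_univ_two]

lemma ee_surj (u : E) (hu : ‖u‖ = 1) : ∃ θ, ee θ = u := by
  rw [EuclideanSpace.norm_eq, Real.sqrt_eq_one, Fin.sum_univ_two] at hu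
  simp only [Real.norm_eq_abs, sq_abs] at hu
  refine ⟨Complex.arg ⟨u 0, u 1⟩, ?_⟩
  have hn : ‖(⟨u 0, u 1⟩ : ℂ)‖ = 1 := by
    rw [Complex.norm_def, Complex.normSq_mk, Real.sqrt_eq_one]; nlinarith
  have h0 : (⟨u 0, u 1⟩ : ℂ) ≠ 0 := by intro h; rw [h] at hn; simp at hn
  ext i
  fin_cases i
  · simp [ee, Complex.cos_arg h0, hn]
  · simp [ee, Complex.sin_arg, hn]

lemma ee_lip : LipschitzWith 1 ee := by
  refine LipschitzWith.of_dist_le_mul fun a b => ?_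
  rw [EuclideanSpace.dist_eq, Real.dist_eq, Fin.sum_univ_two]
  simp only [ee, Real.dist_eq, sq_abs]
  simp only [NNReal.coe_one, one_mul]
  apply Real.sqrt_le_iff.2
  refine ⟨abs_nonneg _, ?_⟩
  rw [sq_abs]
  simp
  have h := Real.one_sub_sq_div_two_le_cos (x := a - b)
  rw [Real.cos_sub] at h
  nlinarith [Real.sin_sq_add_cos_sq a, Real.sin_sq_add_cos_sq b]


lemma supp_le {K : Set E} (hK : IsCompact K) {x : E} (hx : x ∈ K) (u : E) : ⟪x, u⟫ ≤ suppFn K u :=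
  le_csSup (hK.image (by fun_prop)).bddAbove ⟨x, hx, rfl⟩

lemma supp_att {K : Set E} (hK : IsCompact K) (hne : K.Nonempty) (u : E) : ∃ x ∈ K, ⟪x, u⟫ = suppFn K u := by
  obtain ⟨x, hx, h⟩ := (hK.image (f := fun x : E => ⟪x, u⟫) (by fun_prop)).sSup_mem (hne.image _)
  exact ⟨x, hx, h⟩

lemma supp_lip {K : Set E} (hK : IsCompact K) (hne : K.Nonempty) {R : ℝ} (hR : ∀ x ∈ K, ‖x‖ ≤ R) (u v : E) :
    |suppFn K u - suppFn K v| ≤ R * ‖u - v‖ := by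
  have key : ∀ u v : E, suppFn K u - suppFn K v ≤ R * ‖u - v‖ := by
    intro u v
    obtain ⟨x, hx, h⟩ := supp_att hK hne u
    have h1 := supp_le hK hx v
    have h2 : ⟪x, u - v⟫ ≤ ‖x‖ * ‖u - v‖ := real_inner_le_norm _ _
    rw [inner_sub_right] at h2
    nlinarith [hR x hx, norm_nonneg (u - v)]
  rw [abs_le]
  constructor
  · have := key v u
    rw [norm_sub_rev] at this
    linarith
  · exact key u v

lemma mem_of_supp {K : Set E} (hK : IsCompact K) (hne : K.Nonempty) (hc : Convex ℝ K) {x : E} (h : ∀ θ, ⟪x, ee θ⟫ ≤ suppFn K (ee θ)) : x ∈ K := by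
  by_contra hx
  obtain ⟨f, c, h1, h2⟩ := geometric_hahn_banach_closed_point hc hK.isClosed hx
  obtain ⟨u, hu⟩ : ∃ u : E, ∀ y, f y = ⟪y, u⟫ := by
    refine ⟨(InnerProductSpace.toDual ℝ E).symm f, fun y => ?_⟩
    rw [real_inner_comm]; simp
  have hu0 : u ≠ 0 := by
    rintro rfl
    obtain ⟨y, hy⟩ := hne
    have := h1 y hy
    simp [hu] at this h2
    linarith
  have hun : 0 < ‖u‖ := norm_pos_iff.2 hu0
  obtain ⟨θ, hθ⟩ := ee_surj (‖u‖⁻¹ • u) (by rw [norm_smul]; simp [hun.ne'])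
  obtain ⟨y, hy, hy2⟩ := supp_att hK hne (ee θ)
  have h3 := h θ
  rw [← hy2, hθ, inner_smul_right, inner_smul_right] at h3
  have h4 := le_of_mul_le_mul_left h3 (inv_pos.2 hun)
  have := h1 y hy
  rw [hu] at this h2
  linarith

lemma supp_ball {K : Set E} (hK : IsCompact K) {o : E} {r : ℝ} (hr : 0 ≤ r) (h : Metric.closedBall o r ⊆ K) (θ : ℝ) :
    ⟪o, ee θ⟫ + r ≤ suppFn K (ee θ) := by
  have h1 : o + r • ee θ ∈ K := h (by simp [norm_smul, norm_ee, abs_of_nonneg hr])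
  have := supp_le hK h1 (ee θ)
  rw [inner_add_left, inner_smul_left, real_inner_self_eq_norm_sq, norm_ee] at this
  simpa using this

lemma supp_three {K : Set E} (hK : IsCompact K) (hne : K.Nonempty) (θ δ : ℝ) :
    2 * Real.cos δ * suppFn K (ee θ) ≤ suppFn K (ee (θ + δ)) + suppFn K (ee (θ - δ)) := by
  obtain ⟨x, hx, h⟩ := supp_att hK hne (ee θ)
  have h1 := supp_le hK hx (ee (θ + δ))
  have h2 := supp_le hK hx (ee (θ - δ))
  rw [← h]
  rw [inner_ee] at *
  rw [Real.cos_add, Real.sin_add] at h1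
  rw [Real.cos_sub, Real.sin_sub] at h2
  linarith

/-- monotonicity of perimeter -/
lemma perim_mono {P K : Set E} (hPc : Convex ℝ P) (hPcl : IsClosed P) (hPi : (interior P).Nonempty)
    (hK : IsCompact K) (hPK : P ⊆ K) : μH[(1:ℝ)] (frontier P) ≤ μH[(1:ℝ)] (frontier K) := by
  have key : ∀ x : frontier P, ∃ y : E, y ∈ frontier K ∧ ∀ z ∈ P, ⟪z - x, y - x⟫ ≤ 0 := by
    rintro ⟨x, hx⟩
    obtain ⟨f, hf0, hf⟩ := geometric_hahn_banach_of_nonempty_interior_point hPc hx.2 hPi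
    obtain ⟨u, hu⟩ : ∃ u : E, ∀ y, f y = ⟪y, u⟫ := by
      refine ⟨(InnerProductSpace.toDual ℝ E).symm f, fun y => ?_⟩
      rw [real_inner_comm]; simp
    have hu0 : u ≠ 0 := by
      rintro rfl
      apply hf0; ext y; simp [hu]
    have hun : 0 < ‖u‖ := norm_pos_iff.2 hu0
    have hxK : x ∈ K := hPK (hPcl.frontier_subset hx)
    obtain ⟨R, hR⟩ := hK.isBounded.exists_norm_le
    let T : Set ℝ := {t : ℝ | 0 ≤ t ∧ x + t • u ∈ K}
    have hTc : IsCompact T := by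
      refine Metric.isCompact_of_isClosed_isBounded ?_ ?_
      · exact isClosed_Ici.inter (hK.isClosed.preimage (by fun_prop : Continuous fun t : ℝ => x + t • u))
      · refine (Metric.isBounded_Icc (0:ℝ) ((R + ‖x‖) / ‖u‖)).subset ?_
        rintro t ⟨h0, ht⟩
        refine ⟨h0, ?_⟩
        rw [le_div_iff₀ hun]
        have h1 := hR _ ht
        have h2 : ‖t • u‖ ≤ ‖x + t • u‖ + ‖x‖ := by
          calc ‖t • u‖ = ‖(x + t • u) - x‖ := by congr 1; abel
            _ ≤ _ := norm_sub_le _ _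
        rw [norm_smul, Real.norm_of_nonneg h0] at h2
        linarith
    obtain ⟨t, ht, hmax⟩ := hTc.exists_isMaxOn ⟨0, by simp [T, hxK]⟩ continuousOn_id
    refine ⟨x + t • u, ⟨subset_closure ht.2, ?_⟩, ?_⟩
    · intro hint
      have h1 : ∀ᶠ s in nhds t, x + s • u ∈ K := by
        have : ContinuousAt (fun s : ℝ => x + s • u) t := by fun_prop
        exact this (mem_interior_iff_mem_nhds.1 hint)
      obtain ⟨s, hs, hst⟩ := ((h1.filter_mono nhdsWithin_le_nhds).and (self_mem_nhdsWithin (s := Set.Ioi t))).exists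
      have : s ≤ t := hmax (a := s) ⟨ht.1.trans (le_of_lt hst), hs⟩
      exact absurd hst (not_lt.2 this)
    · intro z hz
      have := hf z hz
      rw [hu, hu] at this
      rw [add_sub_cancel_left, inner_smul_right, inner_sub_left]
      exact mul_nonpos_of_nonneg_of_nonpos ht.1 (by linarith)
  choose g hg1 hg2 using key
  have hanti : AntilipschitzWith 1 g := by
    refine AntilipschitzWith.of_le_mul_dist fun a b => ?_
    have h1 := hg2 a b (hPcl.frontier_subset b.2)
    have h2 := hg2 b a (hPcl.frontier_subset a.2)
    simp only [NNReal.coe_one, one_mul]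
    rw [Subtype.dist_eq, dist_eq_norm, dist_eq_norm]
    have h3 : ‖(a:E) - b‖ ^ 2 ≤ ⟪(a:E) - b, g a - g b⟫ := by
      rw [← real_inner_self_eq_norm_sq]
      simp only [inner_sub_left, inner_sub_right] at *
      linarith [real_inner_comm (a:E) b]
    have h4 := real_inner_le_norm ((a:E) - b) (g a - g b)
    by_contra! hlt
    have := norm_nonneg (g a - g b)
    nlinarith
  have h1 := hanti.le_hausdorffMeasure_image (d := 1) zero_le_one Set.univ
  have h2 := (isometry_subtype_coe (s := frontier P)).hausdorffMeasure_image (d := 1) (Or.inl zero_le_one) Set.univ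
  simp only [Set.image_univ, Subtype.range_coe] at h2
  rw [h2]
  refine h1.trans ?_
  simp
  apply measure_mono
  rintro _ ⟨x, rfl⟩
  exact hg1 x

noncomputable def hh (K : Set E) (θ : ℝ) : ℝ := suppFn K (ee θ)

def poly (K : Set E) (δ : ℝ) : Set E := {x | ∀ i : ℤ, ⟪x, ee (i * δ)⟫ ≤ hh K (i * δ)}

noncomputable def vv (K : Set E) (δ θ : ℝ) : E :=
  hh K θ • ee θ + ((hh K (θ + δ) - hh K θ * Real.cos δ) / Real.sin δ) • ee (θ + Real.pi / 2)

lemma vv_prev (K : Set E) (δ θ : ℝ) (hs : Real.sin δ ≠ 0) : vv K δ (θ - δ) =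
    hh K θ • ee θ + (-(hh K (θ - δ) - hh K θ * Real.cos δ) / Real.sin δ) • ee (θ + Real.pi / 2) := by
  unfold vv
  rw [sub_add_cancel]
  generalize hh K θ = A
  generalize hh K (θ - δ) = B
  have h := Real.sin_sq_add_cos_sq δ
  ext i
  fin_cases i
  · simp [ee, Real.cos_sub, Real.sin_sub, Real.cos_add, Real.sin_add]
    field_simp
    linear_combination (B * Real.sin θ) * h
  · simp [ee, Real.cos_sub, Real.sin_sub, Real.cos_add, Real.sin_add]
    field_simp
    linear_combination (-B * Real.cos θ) * h

lemma inner_ee_ee (a b : ℝ) : ⟪ee a, ee b⟫ = Real.cos (b - a) := by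
  rw [inner_ee, Real.cos_sub]; simp [ee]; ring

lemma inner_vv (K : Set E) (δ θ φ : ℝ) : ⟪vv K δ θ, ee φ⟫ = hh K θ * Real.cos (φ - θ) +
    ((hh K (θ + δ) - hh K θ * Real.cos δ) / Real.sin δ) * Real.sin (φ - θ) := by
  unfold vv
  rw [inner_add_left, inner_smul_left, inner_smul_left, inner_ee_ee, inner_ee_ee, ← sub_sub, Real.cos_sub_pi_div_two]
  rfl

lemma inner_three (x : E) (θ δ φ : ℝ) : ⟪x, ee φ⟫ * Real.sin δ =
    ⟪x, ee θ⟫ * Real.sin (θ + δ - φ) + ⟪x, ee (θ + δ)⟫ * Real.sin (φ - θ) := by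
  simp only [inner_ee, Real.sin_sub, Real.cos_add, Real.sin_add]
  have h := Real.sin_sq_add_cos_sq θ
  linear_combination (-(x 0 * Real.cos φ + x 1 * Real.sin φ) * Real.sin δ) * h

lemma inner_vv_self (K : Set E) (δ θ : ℝ) : ⟪vv K δ θ, ee θ⟫ = hh K θ := by simp [inner_vv]

lemma inner_vv_next (K : Set E) (δ θ : ℝ) (hs : Real.sin δ ≠ 0) :
    ⟪vv K δ θ, ee (θ + δ)⟫ = hh K (θ + δ) := by
  rw [inner_vv, add_sub_cancel_left]; field_simp; ring

lemma ee_period (m : ℕ) (δ : ℝ) (hδ : 2 * m * δ = Real.pi) (i : ℤ) :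
    ee ((i % (4 * m : ℤ) : ℤ) * δ) = ee (i * δ) := by
  have h : (i : ℝ) * δ = ((i % (4 * m : ℤ) : ℤ) : ℝ) * δ + ((i / (4 * m : ℤ) : ℤ) : ℝ) * (2 * Real.pi) := by
    rw [← hδ]
    have := Int.emod_add_mul_ediv i (4 * m : ℤ)
    have h2 : (i : ℝ) = ((i % (4 * m : ℤ) : ℤ) : ℝ) + 4 * m * ((i / (4 * m : ℤ) : ℤ) : ℝ) := by
      exact_mod_cast this.symm
    linear_combination δ * h2
  rw [h]
  simp [ee, Real.cos_add_int_mul_two_pi, Real.sin_add_int_mul_two_pi]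

lemma sin_contra (m : ℕ) (hm : 0 < m) (δ : ℝ) (hδ : 2 * m * δ = Real.pi) (k : ℤ)
    (h1 : 0 < Real.sin (k * δ)) (h2 : 0 < Real.sin ((1 - k) * δ)) : False := by
  have hm' : (0:ℝ) < m := by exact_mod_cast hm
  have hδ0 : 0 < δ := by
    by_contra! h
    nlinarith [Real.pi_pos]
  have hp := ee_period m δ hδ k
  have hsin : Real.sin ((k % (4 * m : ℤ) : ℤ) * δ) = Real.sin (k * δ) := by
    have := congrArg (fun x : E => x 1) hp
    simpa [ee] using this
  have hcos : Real.cos ((k % (4 * m : ℤ) : ℤ) * δ) = Real.cos (k * δ) := by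
    have := congrArg (fun x : E => x 0) hp
    simpa [ee] using this
  have hk0 : 0 ≤ k % (4 * m : ℤ) := Int.emod_nonneg _ (by omega)
  have hk1 : k % (4 * m : ℤ) < 4 * m := Int.emod_lt_of_pos _ (by omega)
  rw [sub_mul, one_mul, Real.sin_sub, ← hsin, ← hcos, ← Real.sin_sub] at h2
  rw [← hsin] at h1
  generalize k % (4 * m : ℤ) = j at *
  have hj0 : 0 < j := by
    rcases hk0.lt_or_eq with h | h
    · exact h
    · rw [← h] at h1; simp at h1
  have hj1 : j ≤ 2 * m := by
    by_contra! hlt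
    have hlt' : (2 * m : ℝ) ≤ j := by exact_mod_cast hlt.le
    have hk1' : (j : ℝ) ≤ 4 * m := by exact_mod_cast hk1.le
    have : 0 ≤ Real.sin (j * δ - Real.pi) := Real.sin_nonneg_of_nonneg_of_le_pi (by nlinarith) (by nlinarith)
    rw [Real.sin_sub_pi] at this
    linarith
  have hj0' : (1:ℝ) ≤ j := by exact_mod_cast hj0
  have hj1' : (j:ℝ) ≤ 2 * m := by exact_mod_cast hj1
  have : 0 ≤ Real.sin (j * δ - δ) := Real.sin_nonneg_of_nonneg_of_le_pi (by nlinarith) (by nlinarith)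
  rw [← neg_sub, Real.sin_neg] at h2
  linarith

lemma delta_pos {m : ℕ} (hm : 0 < m) {δ : ℝ} (hδ : 2 * m * δ = Real.pi) : 0 < δ := by
  have hm' : (0:ℝ) < m := by exact_mod_cast hm
  by_contra! h
  nlinarith [Real.pi_pos]

lemma sin_delta_pos {m : ℕ} (hm : 0 < m) {δ : ℝ} (hδ : 2 * m * δ = Real.pi) : 0 < Real.sin δ := by
  have h0 := delta_pos hm hδ
  have hm' : (1:ℝ) ≤ m := by exact_mod_cast hm
  exact Real.sin_pos_of_pos_of_lt_pi h0 (by nlinarith)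

lemma vv_mem {K : Set E} (hK : IsCompact K) (hne : K.Nonempty) {m : ℕ} (hm : 0 < m) {δ : ℝ}
    (hδ : 2 * m * δ = Real.pi) (i : ℤ) : vv K δ (i * δ) ∈ poly K δ := by
  intro j
  have hs := sin_delta_pos hm hδ
  by_contra! hlt
  obtain ⟨p, hp, hp2⟩ := supp_att hK hne (ee (i * δ))
  obtain ⟨q, hq, hq2⟩ := supp_att hK hne (ee (i * δ + δ))
  have hp3 : ⟪p, ee (j * δ)⟫ ≤ hh K (j * δ) := supp_le hK hp _
  have hq3 : ⟪q, ee (j * δ)⟫ ≤ hh K (j * δ) := supp_le hK hq _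
  have hp4 : ⟪p, ee (i * δ + δ)⟫ ≤ hh K (i * δ + δ) := supp_le hK hp _
  have hq4 : ⟪q, ee (i * δ)⟫ ≤ hh K (i * δ) := supp_le hK hq _
  have tv := inner_three (vv K δ (i * δ)) (i * δ) δ (j * δ)
  have tp := inner_three p (i * δ) δ (j * δ)
  have tq := inner_three q (i * δ) δ (j * δ)
  rw [inner_vv_self, inner_vv_next _ _ _ hs.ne'] at tv
  rw [hp2] at tp
  rw [hq2] at tq
  change _ = hh K (i * δ) * _ + _ at tp
  change _ = _ + hh K (i * δ + δ) * _ at tq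
  have e1 : (j * δ - i * δ : ℝ) = ((j - i : ℤ) : ℝ) * δ := by push_cast; ring
  have e2 : (i * δ + δ - j * δ : ℝ) = (1 - ((j - i : ℤ) : ℝ)) * δ := by push_cast; ring
  rw [e1, e2] at tv tp tq
  apply sin_contra m hm δ hδ (j - i)
  · by_contra! hc
    nlinarith
  · by_contra! hc
    nlinarith

lemma poly_convex (K : Set E) (δ : ℝ) : Convex ℝ (poly K δ) := by
  intro x hx y hy a b ha hb hab i
  rw [inner_add_left, inner_smul_left, inner_smul_left]
  have := hx i
  have := hy i
  simp only [RCLike.conj_to_real]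
  calc _ ≤ a * hh K (i * δ) + b * hh K (i * δ) := by gcongr
    _ = _ := by rw [← add_mul, hab, one_mul]

lemma poly_closed (K : Set E) (δ : ℝ) : IsClosed (poly K δ) := by
  unfold poly
  rw [Set.ofPred_forall]
  exact isClosed_iInter fun i => isClosed_le (by fun_prop) continuous_const

/-- edge -/
def edge (K : Set E) (δ : ℝ) (i : ℤ) : Set E := {x | x ∈ poly K δ ∧ ⟪x, ee (i * δ)⟫ = hh K (i * δ)}

lemma eq_decomp (x : E) (θ : ℝ) : x = ⟪x, ee θ⟫ • ee θ + ⟪x, ee (θ + Real.pi / 2)⟫ • ee (θ + Real.pi / 2) := by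
  have h := Real.sin_sq_add_cos_sq θ
  ext i
  fin_cases i
  · simp [inner_ee]
    simp [ee, Real.cos_add, Real.sin_add]
    linear_combination (-x 0) * h
  · simp [inner_ee]
    simp [ee, Real.cos_add, Real.sin_add]
    linear_combination (-x 1) * h

lemma edge_eq {K : Set E} (hK : IsCompact K) (hne : K.Nonempty) {m : ℕ} (hm : 0 < m) {δ : ℝ}
    (hδ : 2 * m * δ = Real.pi) (i : ℤ) :
    edge K δ i = segment ℝ (vv K δ (i * δ - δ)) (vv K δ (i * δ)) := by
  have hs := sin_delta_pos hm hδ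
  have hprev : (i * δ - δ : ℝ) = ((i - 1 : ℤ) : ℝ) * δ := by push_cast; ring
  have hnext : (i * δ + δ : ℝ) = ((i + 1 : ℤ) : ℝ) * δ := by push_cast; ring
  apply Set.Subset.antisymm
  · rintro x ⟨hx, hxi⟩
    have h1 := hx (i - 1)
    have h2 := hx (i + 1)
    rw [← hprev] at h1
    rw [← hnext] at h2
    have hd := eq_decomp x (i * δ)
    rw [hxi] at hd
    rw [vv_prev _ _ _ hs.ne']
    unfold vv
    set s := ⟪x, ee (i * δ + Real.pi / 2)⟫
    rw [hd, inner_add_left, inner_smul_left, inner_smul_left, inner_ee_ee, inner_ee_ee] at h1 h2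
    have c1 : Real.cos (i * δ - δ - i * δ) = Real.cos δ := by rw [← Real.cos_neg]; congr 1; ring
    have c2 : Real.cos (i * δ - δ - (i * δ + Real.pi / 2)) = - Real.sin δ := by
      rw [show (i * δ - δ - (i * δ + Real.pi / 2) : ℝ) = -δ - Real.pi / 2 by ring, Real.cos_sub_pi_div_two, Real.sin_neg]
    have c3 : Real.cos (i * δ + δ - i * δ) = Real.cos δ := by congr 1; ring
    have c4 : Real.cos (i * δ + δ - (i * δ + Real.pi / 2)) = Real.sin δ := by
      rw [show (i * δ + δ - (i * δ + Real.pi / 2) : ℝ) = δ - Real.pi / 2 by ring, Real.cos_sub_pi_div_two]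
    rw [c1, c2] at h1
    rw [c3, c4] at h2
    simp only [RCLike.conj_to_real] at h1 h2
    set a := -(hh K (i * δ - δ) - hh K (i * δ) * Real.cos δ) / Real.sin δ
    set b := (hh K (i * δ + δ) - hh K (i * δ) * Real.cos δ) / Real.sin δ
    have ha : a ≤ s := by rw [div_le_iff₀ hs]; linarith
    have hb : s ≤ b := by rw [le_div_iff₀ hs]; linarith
    have : s ∈ segment ℝ a b := by rw [segment_eq_Icc (ha.trans hb)]; exact ⟨ha, hb⟩
    obtain ⟨t, r, ht, hr, htr, h⟩ := this
    refine ⟨t, r, ht, hr, htr, ?_⟩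
    rw [hd, ← h, smul_add, smul_add, add_add_add_comm, ← add_smul, htr, one_smul, smul_smul, smul_smul, ← add_smul]
    rfl
  · have hmem1 := vv_mem hK hne hm hδ (i - 1)
    rw [← hprev] at hmem1
    have hmem2 := vv_mem hK hne hm hδ i
    have hin1 := inner_vv_next K δ (i * δ - δ) hs.ne'
    rw [sub_add_cancel] at hin1
    have hin2 := inner_vv_self K δ (i * δ)
    intro x hx
    refine ⟨(poly_convex K δ).segment_subset hmem1 hmem2 hx, ?_⟩
    obtain ⟨a, b, ha, hb, hab, rfl⟩ := hx
    rw [inner_add_left, inner_smul_left, inner_smul_left, hin1, hin2, ← add_mul]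
    simp [hab]

noncomputable def ell (K : Set E) (δ θ : ℝ) : ℝ :=
  (hh K (θ + δ) + hh K (θ - δ) - 2 * Real.cos δ * hh K θ) / Real.sin δ

lemma edge_meas {K : Set E} (hK : IsCompact K) (hne : K.Nonempty) {m : ℕ} (hm : 0 < m) {δ : ℝ}
    (hδ : 2 * m * δ = Real.pi) (i : ℤ) :
    μH[(1:ℝ)] (edge K δ i) = ENNReal.ofReal (ell K δ (i * δ)) := by
  have hs := sin_delta_pos hm hδ
  rw [edge_eq hK hne hm hδ, hausdorffMeasure_segment, edist_comm, edist_dist, dist_eq_norm]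
  congr 1
  rw [vv_prev _ _ _ hs.ne']
  unfold vv
  rw [add_sub_add_left_eq_sub, ← sub_smul, norm_smul, norm_ee, mul_one, Real.norm_of_nonneg]
  · unfold ell; field_simp; ring
  · have := supp_three hK hne (i * δ) δ
    rw [← sub_div]
    apply div_nonneg _ hs.le
    unfold hh
    linarith

lemma frontier_poly (K : Set E) {m : ℕ} (hm : 0 < m) {δ : ℝ}
    (hδ : 2 * m * δ = Real.pi) :
    frontier (poly K δ) = ⋃ i ∈ Finset.range (4 * m), edge K δ ((i : ℕ) : ℤ) := by
  ext x
  simp only [Set.mem_iUnion, Finset.mem_range, exists_prop]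
  constructor
  · intro hx
    have hxP := (poly_closed K δ).frontier_subset hx
    by_contra! hcon
    apply hx.2
    have hopen : IsOpen (⋂ i ∈ Finset.range (4 * m), {x : E | ⟪x, ee (((i : ℕ) : ℤ) * δ)⟫ < hh K (((i : ℕ) : ℤ) * δ)}) := by
      apply isOpen_biInter_finset
      intro i _
      exact isOpen_lt (by fun_prop) continuous_const
    refine mem_interior.2 ⟨_, ?_, hopen, ?_⟩
    · intro y hy j
      have hj0 : 0 ≤ j % (4 * m : ℤ) := Int.emod_nonneg _ (by omega)
      have hj1 : j % (4 * m : ℤ) < 4 * m := Int.emod_lt_of_pos _ (by omega)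
      simp only [Set.mem_iInter, Finset.mem_range] at hy
      have := hy (j % (4 * m : ℤ)).toNat (by omega)
      rw [Set.mem_ofPred_eq, Int.toNat_of_nonneg hj0] at this
      unfold hh at *
      rw [ee_period m δ hδ] at this
      exact this.le
    · simp only [Set.mem_iInter, Finset.mem_range]
      intro i hi
      exact lt_of_le_of_ne (hxP i) fun h => hcon i hi ⟨hxP, h⟩
  · rintro ⟨i, hi, hxP, hx⟩
    refine ⟨subset_closure hxP, fun hint => ?_⟩
    have h1 : ∀ᶠ s in nhds (0:ℝ), x + s • ee ((i : ℤ) * δ) ∈ poly K δ := by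
      have : ContinuousAt (fun s : ℝ => x + s • ee ((i : ℤ) * δ)) 0 := by fun_prop
      apply this
      simpa using (mem_interior_iff_mem_nhds.1 hint)
    obtain ⟨s, hs, hst⟩ := ((h1.filter_mono nhdsWithin_le_nhds).and (self_mem_nhdsWithin (s := Set.Ioi (0:ℝ)))).exists
    have := hs i
    rw [inner_add_left, inner_smul_left, inner_ee_ee, hx] at this
    simp at this
    exact absurd hst (not_lt.2 this)

lemma edge_inter {K : Set E} (hK : IsCompact K) (hi : (interior K).Nonempty) {m : ℕ} (hm : 0 < m) {δ : ℝ}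
    (hδ : 2 * m * δ = Real.pi) {i j : ℕ} (hij : i < j) (hj : j < 4 * m) :
    (edge K δ i ∩ edge K δ j).Subsingleton := by
  have h0 := delta_pos hm hδ
  rintro x ⟨⟨-, hx1⟩, ⟨-, hx2⟩⟩ y ⟨⟨-, hy1⟩, ⟨-, hy2⟩⟩
  have hij' : (i:ℝ) + 1 ≤ j := by exact_mod_cast hij
  have hj' : (j:ℝ) < 4 * m := by exact_mod_cast hj
  push_cast at *
  have hi0 : (0:ℝ) ≤ i := by positivity
  have hd0 : 0 < (j:ℝ) * δ - i * δ := by nlinarith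
  have hd1 : (j:ℝ) * δ - i * δ < 2 * Real.pi := by nlinarith
  by_cases hs : Real.sin ((j:ℝ) * δ - i * δ) = 0
  · exfalso
    have hpi : (j:ℝ) * δ - i * δ = Real.pi := by
      have h1 := (Real.sin_eq_zero_iff_of_lt_of_lt (x := (j:ℝ) * δ - i * δ - Real.pi) (by linarith) (by linarith)).1 (by rw [Real.sin_sub_pi, hs, neg_zero])
      linarith
    obtain ⟨o, ho⟩ := hi
    obtain ⟨r, hr, hball⟩ := Metric.nhds_basis_closedBall.mem_iff.1 (mem_interior_iff_mem_nhds.1 ho)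
    have h1 := supp_ball hK hr.le hball (i * δ)
    have h2 := supp_ball hK hr.le hball (j * δ)
    have e1 : (j * δ : ℝ) = i * δ + Real.pi := by linarith
    unfold hh at hx1 hx2
    rw [← hx1] at h1
    rw [← hx2] at h2
    rw [e1] at h2
    simp only [inner_ee, Real.cos_add_pi, Real.sin_add_pi] at h1 h2
    linarith
  · set d := x - y
    have d1 : ⟪x - y, ee (i * δ)⟫ = 0 := by rw [inner_sub_left, hx1, hy1, sub_self]
    have d2 : ⟪x - y, ee (j * δ)⟫ = 0 := by rw [inner_sub_left, hx2, hy2, sub_self]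
    have hd := eq_decomp (x - y) (i * δ)
    have h3 := inner_three (x - y) (i * δ) (j * δ - i * δ) (i * δ + Real.pi / 2)
    rw [add_sub_cancel, d1, d2] at h3
    simp [hs] at h3
    rw [d1, h3] at hd
    simpa [sub_eq_zero] using hd

lemma perim_poly {K : Set E} (hK : IsCompact K) (hi : (interior K).Nonempty) {m : ℕ} (hm : 0 < m) {δ : ℝ}
    (hδ : 2 * m * δ = Real.pi) : μH[(1:ℝ)] (frontier (poly K δ)) =
      ENNReal.ofReal (∑ i ∈ Finset.range (4 * m), ell K δ (i * δ)) := by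
  have hne : K.Nonempty := hi.mono interior_subset
  have hs := sin_delta_pos hm hδ
  have := Measure.nullSingletonClass_hausdorff E (d := 1) one_pos
  rw [frontier_poly K hm hδ, measure_biUnion_finset₀, ENNReal.ofReal_sum_of_nonneg]
  · apply Finset.sum_congr rfl
    intro i _
    rw [edge_meas hK hne hm hδ]
    simp
  · intro i _
    have := supp_three hK hne (i * δ) δ
    apply div_nonneg _ hs.le
    unfold hh
    linarith
  · intro i hi' j hj' hne'
    simp only [Finset.coe_range, Set.mem_Iio] at hi' hj'
    rcases lt_or_gt_of_ne hne' with h | h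
    · exact (edge_inter hK hi hm hδ h hj').measure_zero _
    · have := (edge_inter hK hi hm hδ h hi').measure_zero μH[(1:ℝ)]
      rw [Set.inter_comm] at this
      exact this
  · intro i _
    apply MeasurableSet.nullMeasurableSet
    apply IsClosed.measurableSet
    exact (poly_closed K δ).inter (isClosed_eq (by fun_prop) continuous_const)

lemma hh_two_pi (K : Set E) (θ : ℝ) : hh K (θ + 2 * Real.pi) = hh K θ := by
  simp [hh, ee]

lemma sum_ell (K : Set E) {m : ℕ} {δ : ℝ} (hδ : 2 * m * δ = Real.pi) :
    ∑ i ∈ Finset.range (4 * m), ell K δ (i * δ) =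
      2 * (1 - Real.cos δ) / Real.sin δ * ∑ i ∈ Finset.range (4 * m), hh K (i * δ) := by
  have h1 : ∑ i ∈ Finset.range (4 * m), hh K (i * δ + δ) = ∑ i ∈ Finset.range (4 * m), hh K (i * δ) := by
    have a := Finset.sum_range_succ (fun i : ℕ => hh K (i * δ)) (4 * m)
    have b := Finset.sum_range_succ' (fun i : ℕ => hh K (i * δ)) (4 * m)
    have c : hh K ((4 * m : ℕ) * δ) = hh K ((0 : ℕ) * δ) := by
      rw [← hh_two_pi K ((0 : ℕ) * δ), ← hδ]; congr 1; push_cast; ring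
    have d : ∑ i ∈ Finset.range (4 * m), hh K ((i + 1 : ℕ) * δ) = ∑ i ∈ Finset.range (4 * m), hh K (i * δ + δ) := by
      apply Finset.sum_congr rfl; intro i _; congr 1; push_cast; ring
    linarith
  have h2 : ∑ i ∈ Finset.range (4 * m), hh K (i * δ - δ) = ∑ i ∈ Finset.range (4 * m), hh K (i * δ) := by
    have a := Finset.sum_range_succ (fun i : ℕ => hh K (i * δ - δ)) (4 * m)
    have b := Finset.sum_range_succ' (fun i : ℕ => hh K (i * δ - δ)) (4 * m)
    have c : hh K ((4 * m : ℕ) * δ - δ) = hh K ((0 : ℕ) * δ - δ) := by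
      rw [← hh_two_pi K ((0 : ℕ) * δ - δ), ← hδ]; congr 1; push_cast; ring
    have d : ∑ i ∈ Finset.range (4 * m), hh K ((i + 1 : ℕ) * δ - δ) = ∑ i ∈ Finset.range (4 * m), hh K (i * δ) := by
      apply Finset.sum_congr rfl; intro i _; congr 1; push_cast; ring
    linarith
  unfold ell
  rw [← Finset.sum_div, Finset.sum_sub_distrib, Finset.sum_add_distrib, h1, h2, ← Finset.mul_sum]
  ring

lemma hh_lip {K : Set E} (hK : IsCompact K) (hne : K.Nonempty) {R : ℝ} (hR : ∀ x ∈ K, ‖x‖ ≤ R) (a b : ℝ) :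
    |hh K a - hh K b| ≤ R * |a - b| := by
  have h := supp_lip hK hne hR (ee a) (ee b)
  have h2 := ee_lip.dist_le_mul a b
  rw [dist_eq_norm, Real.dist_eq] at h2
  simp only [NNReal.coe_one, one_mul] at h2
  obtain ⟨x, hx⟩ := hne
  have hR0 : 0 ≤ R := (norm_nonneg x).trans (hR x hx)
  exact h.trans (mul_le_mul_of_nonneg_left h2 hR0)

lemma supp_cont {K : Set E} (hK : IsCompact K) (hne : K.Nonempty) : Continuous (suppFn K) := by
  obtain ⟨R, hR⟩ := hK.isBounded.exists_norm_le
  have hR0 : 0 ≤ R := by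
    obtain ⟨x, hx⟩ := hne
    exact (norm_nonneg x).trans (hR x hx)
  refine (LipschitzWith.of_dist_le_mul (K := ⟨R, hR0⟩) fun u v => ?_).continuous
  rw [Real.dist_eq, dist_eq_norm]
  exact supp_lip hK hne hR u v

lemma hh_cont {K : Set E} (hK : IsCompact K) (hne : K.Nonempty) : Continuous (hh K) :=
  (supp_cont hK hne).comp ee_lip.continuous

lemma riemann {K : Set E} (hK : IsCompact K) (hne : K.Nonempty) {R : ℝ} (hR : ∀ x ∈ K, ‖x‖ ≤ R)
    {m : ℕ} (hm : 0 < m) {δ : ℝ} (hδ : 2 * m * δ = Real.pi) :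
    |(∫ θ in (0:ℝ)..(2 * Real.pi), hh K θ) - δ * ∑ i ∈ Finset.range (4 * m), hh K (i * δ)|
      ≤ 2 * Real.pi * R * δ := by
  have h0 := delta_pos hm hδ
  have hR0 : 0 ≤ R := by
    obtain ⟨x, hx⟩ := hne
    exact (norm_nonneg x).trans (hR x hx)
  have hc := hh_cont hK hne
  have hsum := intervalIntegral.sum_integral_adjacent_intervals (μ := volume) (f := hh K)
    (a := fun k : ℕ => (k : ℝ) * δ) (n := 4 * m) (fun k _ => hc.intervalIntegrable _ _)
  have e : ((4 * m : ℕ) : ℝ) * δ = 2 * Real.pi := by rw [← hδ]; push_cast; ring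
  simp only [e, Nat.cast_zero, zero_mul] at hsum
  rw [← hsum, Finset.mul_sum, ← Finset.sum_sub_distrib]
  have hterm : ∀ i ∈ Finset.range (4 * m), |(∫ θ in ((i:ℕ):ℝ) * δ..((i + 1 : ℕ):ℝ) * δ, hh K θ) - δ * hh K (i * δ)| ≤ R * δ * δ := by
    intro i _
    have e1 : ((i + 1 : ℕ):ℝ) * δ - (i:ℝ) * δ = δ := by push_cast; ring
    have e2 : (∫ θ in ((i:ℕ):ℝ) * δ..((i + 1 : ℕ):ℝ) * δ, hh K θ) - δ * hh K (i * δ)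
        = ∫ θ in ((i:ℕ):ℝ) * δ..((i + 1 : ℕ):ℝ) * δ, (hh K θ - hh K (i * δ)) := by
      rw [intervalIntegral.integral_sub (hc.intervalIntegrable _ _) (by simp), intervalIntegral.integral_const, e1, smul_eq_mul]
    rw [e2]
    have := intervalIntegral.norm_integral_le_of_norm_le_const (a := ((i:ℕ):ℝ) * δ) (b := ((i + 1 : ℕ):ℝ) * δ) (C := R * δ)
      (f := fun θ => hh K θ - hh K (i * δ)) ?_
    · rw [e1, abs_of_pos h0] at this
      exact this
    · intro θ hθ
      rw [Set.uIoc_of_le (by linarith)] at hθ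
      refine (hh_lip hK hne hR _ _).trans (mul_le_mul_of_nonneg_left ?_ hR0)
      rw [abs_le]; constructor <;> linarith [hθ.1, hθ.2]
  refine (Finset.abs_sum_le_sum_abs _ _).trans ((Finset.sum_le_sum hterm).trans ?_)
  rw [Finset.sum_const, Finset.card_range, nsmul_eq_mul, ← e]
  apply le_of_eq; ring

lemma subset_poly {K : Set E} (hK : IsCompact K) (δ : ℝ) : K ⊆ poly K δ :=
  fun _ hx _ => supp_le hK hx _

lemma hh_le {K : Set E} (hK : IsCompact K) (hne : K.Nonempty) {R : ℝ} (hR : ∀ x ∈ K, ‖x‖ ≤ R) (θ : ℝ) :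
    hh K θ ≤ R := by
  obtain ⟨x, hx, h⟩ := supp_att hK hne (ee θ)
  have := real_inner_le_norm x (ee θ)
  rw [norm_ee, mul_one] at this
  unfold hh
  linarith [hR x hx]

lemma poly_bdd {K : Set E} (hK : IsCompact K) (hne : K.Nonempty) {R : ℝ} (hR : ∀ x ∈ K, ‖x‖ ≤ R)
    {m : ℕ} {δ : ℝ} (hδ : 2 * m * δ = Real.pi) {x : E} (hx : x ∈ poly K δ) :
    ‖x‖ ≤ 2 * R := by
  have b := fun i : ℤ => (hx i).trans (hh_le hK hne hR _)
  have b0 := b 0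
  have b1 := b m
  have b2 := b (2 * m)
  have b3 := b (3 * m)
  push_cast at b0 b1 b2 b3
  rw [show (m * δ : ℝ) = Real.pi / 2 by linarith] at b1
  rw [show (2 * m * δ : ℝ) = Real.pi by linarith] at b2
  rw [show (3 * m * δ : ℝ) = Real.pi / 2 + Real.pi by linarith] at b3
  simp [inner_ee, Real.cos_add_pi, Real.sin_add_pi] at b0 b1 b2 b3
  have hR0 : 0 ≤ R := by linarith
  rw [EuclideanSpace.norm_eq, Fin.sum_univ_two]
  apply Real.sqrt_le_iff.2 ⟨by linarith, ?_⟩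
  simp only [Real.norm_eq_abs, sq_abs]
  nlinarith

lemma poly_sub {K : Set E} (hK : IsCompact K) (hcv : Convex ℝ K) (hne : K.Nonempty) {R : ℝ} (hR : ∀ x ∈ K, ‖x‖ ≤ R)
    {o : E} {r : ℝ} (hr : 0 < r) (hball : Metric.closedBall o r ⊆ K)
    {m : ℕ} (hm : 0 < m) {δ : ℝ} (hδ : 2 * m * δ = Real.pi) :
    poly K δ ⊆ AffineMap.homothety o (1 + 3 * R / r * δ) '' K := by
  have h0 := delta_pos hm hδ
  have hR0 : 0 ≤ R := by
    obtain ⟨x, hx⟩ := hne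
    exact (norm_nonneg x).trans (hR x hx)
  have hc : 0 < 1 + 3 * R / r * δ := by positivity
  set c := 1 + 3 * R / r * δ with hcdef
  intro x hx
  refine ⟨o + c⁻¹ • (x - o), ?_, ?_⟩
  · apply mem_of_supp hK hne hcv
    intro θ
    have hb := supp_ball hK hr.le hball θ
    change _ ≤ hh K θ at hb
    change _ ≤ hh K θ
    have hfl : |θ - (⌊θ / δ⌋ : ℤ) * δ| ≤ δ := by
      have h1 := Int.floor_le (θ / δ)
      have h2 := Int.lt_floor_add_one (θ / δ)
      rw [le_div_iff₀ h0] at h1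
      rw [div_lt_iff₀ h0] at h2
      rw [abs_le]; constructor <;> linarith
    set φ := ((⌊θ / δ⌋ : ℤ) : ℝ) * δ with hφ
    have h1 : ⟪x, ee φ⟫ ≤ hh K φ := hx _
    have h2 : hh K φ - hh K θ ≤ R * δ := by
      refine (le_abs_self _).trans ((hh_lip hK hne hR _ _).trans ?_)
      rw [abs_sub_comm]; gcongr
    have h3 : ⟪x, ee θ - ee φ⟫ ≤ 2 * R * δ := by
      refine (real_inner_le_norm _ _).trans ?_
      have := ee_lip.dist_le_mul θ φ
      rw [dist_eq_norm, Real.dist_eq] at this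
      simp only [NNReal.coe_one, one_mul] at this
      exact mul_le_mul (poly_bdd hK hne hR hδ hx) (this.trans hfl) (norm_nonneg _) (by positivity)
    rw [inner_sub_right] at h3
    rw [inner_add_left, inner_smul_left, inner_sub_left]
    simp only [RCLike.conj_to_real]
    have h4 : ⟪x, ee θ⟫ - ⟪o, ee θ⟫ ≤ c * (hh K θ - ⟪o, ee θ⟫) := by
      have h5 : 3 * R * δ ≤ 3 * R / r * δ * (hh K θ - ⟪o, ee θ⟫) := by
        calc 3 * R * δ = 3 * R / r * δ * r := by field_simp
          _ ≤ _ := by gcongr; linarith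
      rw [hcdef, add_mul, one_mul]
      linarith
    have h6 : c⁻¹ * (⟪x, ee θ⟫ - ⟪o, ee θ⟫) ≤ hh K θ - ⟪o, ee θ⟫ := by
      rw [inv_mul_le_iff₀ hc]; exact h4
    linarith
  · rw [AffineMap.homothety_apply]
    simp [hc.ne']

lemma frontier_homothety {K : Set E} (hK : IsCompact K) (o : E) {c : ℝ} (hc : c ≠ 0) :
    frontier (AffineMap.homothety o c '' K) ⊆ AffineMap.homothety o c '' frontier K := by
  have hcont : Continuous (AffineMap.homothety o c : E → E) := AffineMap.homothety_continuous o c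
  intro x hx
  obtain ⟨y, hy, rfl⟩ := (hK.image hcont).isClosed.frontier_subset hx
  refine ⟨y, ⟨subset_closure hy, fun hint => hx.2 ?_⟩, rfl⟩
  have ho := (AffineMap.homothety_isOpenMap o c hc) _ (isOpen_interior (s := K))
  exact interior_maximal (Set.image_mono interior_subset) ho ⟨y, hint, rfl⟩

lemma two_sided {K : Set E} (hK : IsCompact K) (hcv : Convex ℝ K) (hi : (interior K).Nonempty) :
    μH[(1:ℝ)] (frontier K) ≠ ⊤ ∧ ∃ C : ℝ, 0 ≤ C ∧ ∀ (m : ℕ) (δ : ℝ), 0 < m → 2 * m * δ = Real.pi →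
      (μH[(1:ℝ)] (frontier K)).toReal ≤ ∑ i ∈ Finset.range (4 * m), ell K δ (i * δ) ∧
      ∑ i ∈ Finset.range (4 * m), ell K δ (i * δ) ≤ (1 + C * δ) * (μH[(1:ℝ)] (frontier K)).toReal := by
  have hne : K.Nonempty := hi.mono interior_subset
  obtain ⟨R, hR⟩ := hK.isBounded.exists_norm_le
  have hR0 : 0 ≤ R := by
    obtain ⟨x, hx⟩ := hne
    exact (norm_nonneg x).trans (hR x hx)
  obtain ⟨o, ho⟩ := id hi
  obtain ⟨r, hr, hball⟩ := Metric.nhds_basis_closedBall.mem_iff.1 (mem_interior_iff_mem_nhds.1 ho)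
  have upper : ∀ (m : ℕ) (δ : ℝ), 0 < m → 2 * m * δ = Real.pi →
      μH[(1:ℝ)] (frontier K) ≤ ENNReal.ofReal (∑ i ∈ Finset.range (4 * m), ell K δ (i * δ)) := by
    intro m δ hm hδ
    rw [← perim_poly hK hi hm hδ]
    refine perim_mono hcv hK.isClosed hi ?_ (subset_poly hK δ)
    refine Metric.isCompact_of_isClosed_isBounded (poly_closed K δ) ?_
    exact isBounded_iff_forall_norm_le.2 ⟨2 * R, fun x hx => poly_bdd hK hne hR hδ hx⟩
  have hfin : μH[(1:ℝ)] (frontier K) ≠ ⊤ :=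
    ne_top_of_le_ne_top ENNReal.ofReal_ne_top (upper 1 (Real.pi / 2) one_pos (by push_cast; ring))
  have hnn : ∀ (m : ℕ) (δ : ℝ), 0 < m → 2 * m * δ = Real.pi → 0 ≤ ∑ i ∈ Finset.range (4 * m), ell K δ (i * δ) := by
    intro m δ hm hδ
    apply Finset.sum_nonneg
    intro i _
    have := supp_three hK hne (i * δ) δ
    apply div_nonneg _ (sin_delta_pos hm hδ).le
    unfold hh
    linarith
  refine ⟨hfin, 3 * R / r, by positivity, fun m δ hm hδ => ⟨?_, ?_⟩⟩
  · exact ENNReal.toReal_le_of_le_ofReal (hnn m δ hm hδ) (upper m δ hm hδ)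
  · have h0 := delta_pos hm hδ
    have hc : 0 < 1 + 3 * R / r * δ := by positivity
    have h1 : μH[(1:ℝ)] (frontier (poly K δ)) ≤ μH[(1:ℝ)] (frontier (AffineMap.homothety o (1 + 3 * R / r * δ) '' K)) := by
      refine perim_mono (poly_convex K δ) (poly_closed K δ) (hi.mono (interior_mono (subset_poly hK δ)))
        (hK.image (AffineMap.homothety_continuous o _)) (poly_sub hK hcv hne hR hr hball hm hδ)
    have h2 := h1.trans (measure_mono (frontier_homothety hK o hc.ne'))
    rw [hausdorffMeasure_homothety_image zero_le_one o hc.ne', perim_poly hK hi hm hδ] at h2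
    have h3 := ENNReal.toReal_mono (by
      simp only [NNReal.rpow_one, ENNReal.smul_def, smul_eq_mul]
      exact ENNReal.mul_ne_top ENNReal.coe_ne_top hfin) h2
    rw [ENNReal.toReal_ofReal (hnn m δ hm hδ)] at h3
    simp only [NNReal.rpow_one, ENNReal.smul_def, smul_eq_mul, ENNReal.toReal_mul, ENNReal.coe_toReal, coe_nnnorm] at h3
    rwa [Real.norm_of_nonneg hc.le] at h3

lemma perim_main {K : Set E} (hK : IsCompact K) (hcv : Convex ℝ K) (hi : (interior K).Nonempty) :
    (μH[(1:ℝ)] (frontier K)).toReal = ∫ θ in (0:ℝ)..(2 * Real.pi), hh K θ := by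
  have hne : K.Nonempty := hi.mono interior_subset
  obtain ⟨R, hR⟩ := hK.isBounded.exists_norm_le
  obtain ⟨-, C, hC, hb⟩ := two_sided hK hcv hi
  set p := (μH[(1:ℝ)] (frontier K)).toReal
  set I := ∫ θ in (0:ℝ)..(2 * Real.pi), hh K θ
  let d : ℕ → ℝ := fun m => Real.pi / 2 / ((m : ℝ) + 1)
  have hd : ∀ m : ℕ, 2 * ((m + 1 : ℕ) : ℝ) * d m = Real.pi := by
    intro m; simp only [d]; push_cast; field_simp
  have hdpos : ∀ m, 0 < d m := fun m => delta_pos (Nat.succ_pos m) (hd m)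
  have hd0 : Filter.Tendsto d Filter.atTop (nhds 0) := by
    have := tendsto_one_div_add_atTop_nhds_zero_nat (𝕜 := ℝ)
    have := this.const_mul (Real.pi / 2)
    simpa [d, div_eq_mul_inv] using this
  have hd0' : Filter.Tendsto d Filter.atTop (nhdsWithin 0 {0}ᶜ) :=
    tendsto_nhdsWithin_iff.2 ⟨hd0, Filter.Eventually.of_forall fun m => (hdpos m).ne'⟩
  let S : ℕ → ℝ := fun m => d m * ∑ i ∈ Finset.range (4 * (m + 1)), hh K (i * d m)
  have hS : Filter.Tendsto S Filter.atTop (nhds I) := by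
    rw [tendsto_iff_dist_tendsto_zero]
    refine squeeze_zero (fun _ => dist_nonneg) (g := fun m => 2 * Real.pi * R * d m) (fun m => ?_) ?_
    · rw [dist_comm, Real.dist_eq]
      exact riemann hK hne hR (Nat.succ_pos m) (hd m)
    · simpa using hd0.const_mul (2 * Real.pi * R)
  have hlim : Filter.Tendsto (fun x : ℝ => 2 * (1 - Real.cos x) / Real.sin x / x) (nhdsWithin 0 {0}ᶜ) (nhds 1) := by
    have hsc : Filter.Tendsto Real.sinc (nhdsWithin 0 {0}ᶜ) (nhds 1) := by
      have := (Real.continuous_sinc.tendsto 0).mono_left (nhdsWithin_le_nhds (s := {0}ᶜ))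
      simpa using this
    have hcos : Filter.Tendsto Real.cos (nhdsWithin 0 {0}ᶜ) (nhds 1) := by
      have := (Real.continuous_cos.tendsto 0).mono_left (nhdsWithin_le_nhds (s := {0}ᶜ))
      simpa using this
    have h1 : Filter.Tendsto (fun x => 2 * Real.sinc x / (1 + Real.cos x)) (nhdsWithin 0 {0}ᶜ) (nhds 1) := by
      have := (hsc.const_mul 2).div (hcos.const_add 1) (by norm_num)
      norm_num at this
      exact this
    refine h1.congr' ?_
    have hne0 : ∀ᶠ x in nhdsWithin (0:ℝ) {0}ᶜ, Real.sinc x ≠ 0 :=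
      hsc.eventually_ne one_ne_zero
    have hne1 : ∀ᶠ x in nhdsWithin (0:ℝ) {0}ᶜ, 1 + Real.cos x ≠ 0 :=
      (hcos.const_add 1).eventually_ne (by norm_num)
    filter_upwards [hne0, hne1, self_mem_nhdsWithin] with x hx0 hx1 hx
    have hx' : x ≠ 0 := hx
    rw [Real.sinc_of_ne_zero hx'] at hx0 ⊢
    have hsx : Real.sin x ≠ 0 := fun h => hx0 (by rw [h, zero_div])
    field_simp
    linear_combination Real.sin_sq_add_cos_sq x
  have hL : Filter.Tendsto (fun m => ∑ i ∈ Finset.range (4 * (m + 1)), ell K (d m) (i * d m)) Filter.atTop (nhds I) := by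
    have := (hlim.comp hd0').mul hS
    rw [one_mul] at this
    refine this.congr fun m => ?_
    rw [sum_ell K (hd m)]
    simp only [Function.comp, S]
    have := (hdpos m).ne'
    field_simp
  apply le_antisymm
  · exact ge_of_tendsto' hL fun m => (hb (m + 1) (d m) (Nat.succ_pos m) (hd m)).1
  · have h2 : Filter.Tendsto (fun m => (1 + C * d m) * p) Filter.atTop (nhds p) := by
      simpa using ((hd0.const_mul C).const_add 1).mul_const p
    exact le_of_tendsto_of_tendsto' hL h2 fun m => (hb (m + 1) (d m) (Nat.succ_pos m) (hd m)).2

lemma ee_surj' (u : E) (hu : ‖u‖ = 1) : ∃ θ ∈ Set.Ioc 0 (2 * Real.pi), ee θ = u := by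
  obtain ⟨θ, rfl⟩ := ee_surj u hu
  refine ⟨toIocMod Real.two_pi_pos 0 θ, by simpa using toIocMod_mem_Ioc Real.two_pi_pos 0 θ, ?_⟩
  rw [toIocMod, zsmul_eq_mul]
  simp only [ee]
  rw [Real.cos_sub_int_mul_two_pi, Real.sin_sub_int_mul_two_pi]

lemma hh_ball (θ : ℝ) : hh (Metric.closedBall 0 1) θ = 1 := by
  apply le_antisymm
  · exact hh_le (isCompact_closedBall _ _) ⟨0, by simp⟩ (fun x hx => by simpa using hx) θ
  · have := supp_ball (isCompact_closedBall (0:E) 1) zero_le_one subset_rfl θ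
    simpa [hh] using this

lemma meas_sphere : μH[(1:ℝ)] (Metric.sphere (0:E) 1) = ENNReal.ofReal (2 * Real.pi) := by
  have hi : (interior (Metric.closedBall (0:E) 1)).Nonempty := by
    rw [interior_closedBall _ one_ne_zero]; exact ⟨0, by simp⟩
  have h := perim_main (isCompact_closedBall (0:E) 1) (convex_closedBall _ _) hi
  have hf := (two_sided (isCompact_closedBall (0:E) 1) (convex_closedBall _ _) hi).1
  rw [frontier_closedBall _ one_ne_zero] at h hf
  simp only [hh_ball] at h
  rw [← ENNReal.ofReal_toReal hf, h]
  simp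

lemma sphere_measure : (μH[(1:ℝ)]).restrict (Metric.sphere (0:E) 1) =
    Measure.map ee (volume.restrict (Set.Ioc 0 (2 * Real.pi))) := by
  have hm : Measurable ee := ee_lip.continuous.measurable
  have : IsFiniteMeasure ((μH[(1:ℝ)]).restrict (Metric.sphere (0:E) 1)) := by
    refine ⟨?_⟩
    rw [Measure.restrict_apply_univ, meas_sphere]; exact ENNReal.ofReal_lt_top
  apply Measure.eq_of_le_of_measure_univ_eq
  · rw [Measure.le_iff]
    intro s hs
    rw [Measure.restrict_apply hs, Measure.map_apply hm hs, Measure.restrict_apply (hm hs)]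
    calc μH[(1:ℝ)] (s ∩ Metric.sphere (0:E) 1) ≤ μH[(1:ℝ)] (ee '' (ee ⁻¹' s ∩ Set.Ioc 0 (2 * Real.pi))) := by
          apply measure_mono
          rintro x ⟨hx, hx1⟩
          obtain ⟨θ, hθ, rfl⟩ := ee_surj' x (by simpa using hx1)
          exact ⟨θ, ⟨hx, hθ⟩, rfl⟩
      _ ≤ μH[(1:ℝ)] (ee ⁻¹' s ∩ Set.Ioc 0 (2 * Real.pi)) := by
          simpa using ee_lip.hausdorffMeasure_image_le (d := 1) zero_le_one (ee ⁻¹' s ∩ Set.Ioc 0 (2 * Real.pi))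
      _ = _ := by rw [hausdorffMeasure_real]
  · rw [Measure.restrict_apply_univ, meas_sphere, Measure.map_apply hm .univ]
    simp

end CauchyPerim

/-- Cauchy-type formula in the plane: the perimeter of a planar convex body equals the integral
of its support function over the unit circle. -/
theorem perimeter_eq_integral_suppFn
    (K : Set (EuclideanSpace ℝ (Fin 2)))
    (hKcp : IsCompact K) (hKcv : Convex ℝ K) (hKint : (interior K).Nonempty) :
    (μH[(1 : ℝ)] (frontier K)).toReal =
      ∫ u in Metric.sphere (0 : EuclideanSpace ℝ (Fin 2)) 1, suppFn K u ∂μH[(1 : ℝ)] := by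
  have hne : K.Nonempty := hKint.mono interior_subset
  rw [CauchyPerim.perim_main hKcp hKcv hKint, CauchyPerim.sphere_measure,
    integral_map CauchyPerim.ee_lip.continuous.measurable.aemeasurable
      (CauchyPerim.supp_cont hKcp hne).aestronglyMeasurable,
    intervalIntegral.integral_of_le Real.two_pi_pos.le]
  rfl
end

section
/- (Planar Leidenfrost problem) Let K be a convex body in ℝ², with vertical breadth b(K) := h_K(e₂) + h_K(−e₂) and perimeter H^1(∂K). Suppose K is Pareto-optimal for the problem of minimizing the pair (perimeter, vertical breadth) among convex bodies of at least the same area; that is, there is no convex body L in ℝ² with vol(L) ≥ vol(K), H^1(∂L) ≤ H^1(∂K) and b(L) ≤ b(K) such that at least one of the two latter inequalities is strict. Then K is a stadium: there exist c ∈ ℝ², r > 0 and s ≥ 0 such that K is the Minkowski sum of the horizontal segment from c − s·e₁ to c + s·e₁ and the closed disk of radius r centered at the origin. -/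
open MeasureTheory Pointwise RealInnerProductSpace

/-- The vertical breadth of `K ⊆ ℝ²`. -/
noncomputable def vbreadth (K : Set (EuclideanSpace ℝ (Fin 2))) : ℝ :=
  suppFn K (EuclideanSpace.single 1 1) + suppFn K (-(EuclideanSpace.single 1 1))

open Set Filter Topology

theorem concave_ac {r t : ℝ} {g : ℝ → ℝ} (hg : ConcaveOn ℝ (Icc (-r) r) g) (ht : 0 < t)
    (htr : t < r) : AbsolutelyContinuousOnInterval g (-t) t := by
  have h1 : ConcaveOn ℝ (Ioo (-r) r) g := hg.subset Ioo_subset_Icc_self (convex_Ioo _ _)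
  have h2 := h1.locallyLipschitzOn isOpen_Ioo
  have h3 : Icc (-t) t ⊆ Ioo (-r) r := fun x hx => ⟨by linarith [hx.1], by linarith [hx.2]⟩
  obtain ⟨K, hK⟩ := (h2.mono h3).exists_lipschitzOnWith_of_compact isCompact_Icc
  apply LipschitzOnWith.absolutelyContinuousOnInterval (K := K)
  rwa [uIcc_of_le (by linarith)]

theorem slope_tendsto {g : ℝ → ℝ} {x m : ℝ} (h : HasDerivAt g m x) :
    Tendsto (fun ε => (g (x + ε) - g (x - ε)) / (2 * ε)) (𝓝[>] 0) (𝓝 m) := by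
  have h1 : HasDerivAt (fun ε => g (x + ε) - g (x - ε)) (2 * m) 0 := by
    have a : HasDerivAt (fun ε => g (x + ε)) m 0 := by
      have := HasDerivAt.comp_const_add x 0 (f := g) (f' := m) (by simpa using h)
      simpa using this
    have b : HasDerivAt (fun ε => g (x - ε)) (-m) 0 := by
      have := HasDerivAt.comp_const_sub x 0 (f := g) (f' := m) (by simpa using h)
      simpa using this
    have := a.sub b
    rwa [show m - -m = 2 * m by ring] at this
  have h2 := h1.tendsto_slope_zero_right
  have h3 := h2.const_mul (1/2)
  refine (h3.congr ?_).trans (by rw [show (1/2 : ℝ) * (2 * m) = m by ring])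
  intro ε
  simp
  ring

theorem chord_tendsto {g : ℝ → ℝ} {x m : ℝ} (h : HasDerivAt g m x) :
    Tendsto (fun ε => √((2 * ε) ^ 2 + (g (x + ε) - g (x - ε)) ^ 2) / (2 * ε)) (𝓝[>] 0)
      (𝓝 √(1 + m ^ 2)) := by
  have h1 := ((slope_tendsto h).pow 2).const_add 1
  have h2 := (Real.continuous_sqrt.tendsto _).comp h1
  refine h2.congr' ?_
  filter_upwards [self_mem_nhdsWithin] with ε hε
  have hε : (0:ℝ) < 2 * ε := by have : (0:ℝ) < ε := hε; linarith
  simp only [Function.comp]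
  rw [eq_div_iff hε.ne']
  nth_rewrite 2 [← Real.sqrt_sq hε.le]
  rw [← Real.sqrt_mul (by positivity)]
  congr 1
  have hε0 : ε ≠ 0 := by intro h0; simp [h0] at hε
  field_simp

theorem length_lower {r t : ℝ} {g h : ℝ → ℝ} (ht : 0 < t) (htr : t < r)
    (hg : AbsolutelyContinuousOnInterval g (-t) t) (hh : AbsolutelyContinuousOnInterval h (-t) t)
    (ν : Measure ℝ) [IsFiniteMeasure ν]
    (hν : ∀ c d, -r < c → c ≤ d → d < r →
      ENNReal.ofReal (√((d - c) ^ 2 + (g d - g c) ^ 2) + √((d - c) ^ 2 + (h d - h c) ^ 2))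
        ≤ ν (Icc c d)) :
    ∫⁻ y in Ioo (-t) t, ENNReal.ofReal (√(1 + (deriv g y) ^ 2) + √(1 + (deriv h y) ^ 2))
      ≤ ν (Ioo (-t) t) := by
  calc _ ≤ ∫⁻ y in Ioo (-t) t, ν.rnDeriv volume y := by
        apply lintegral_mono_ae
        refine (ae_restrict_iff' measurableSet_Ioo).2 ?_
        filter_upwards [hg.ae_differentiableAt, hh.ae_differentiableAt,
          Besicovitch.ae_tendsto_rnDeriv ν volume] with x h1 h2 h3 hx
        have hx' : x ∈ uIcc (-t) t := by
          rw [uIcc_of_le (by linarith)]; exact Ioo_subset_Icc_self hx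
        have c1 := chord_tendsto (h1 hx').hasDerivAt
        have c2 := chord_tendsto (h2 hx').hasDerivAt
        have c3 := ENNReal.tendsto_ofReal (c1.add c2)
        refine le_of_tendsto_of_tendsto c3 h3 ?_
        have e1 : ∀ᶠ ε in 𝓝[>] (0:ℝ), ε < r - t :=
          nhdsWithin_le_nhds (Iio_mem_nhds (by linarith))
        filter_upwards [self_mem_nhdsWithin, e1] with ε hε hε2
        have hε : (0:ℝ) < ε := hε
        rw [Real.closedBall_eq_Icc, Real.volume_Icc]
        have := hν (x - ε) (x + ε) (by linarith [hx.1]) (by linarith) (by linarith [hx.2])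
        rw [show x + ε - (x - ε) = 2 * ε by ring] at this ⊢
        rw [← add_div, ENNReal.ofReal_div_of_pos (by linarith)]
        gcongr
    _ = (volume.withDensity (ν.rnDeriv volume)) (Ioo (-t) t) := by
        rw [withDensity_apply _ measurableSet_Ioo]
    _ ≤ ν (Ioo (-t) t) := Measure.withDensity_rnDeriv_le _ _ _

/-- defect integrand -/
noncomputable def defi (r : ℝ) (g : ℝ → ℝ) (y : ℝ) : ℝ :=
  r * √(1 + (deriv g y) ^ 2) - √(r ^ 2 - y ^ 2) + y * deriv g y

theorem cs_aux {r y m : ℝ} (hr : 0 < r) (hy : y ^ 2 < r ^ 2) :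
    0 ≤ r * √(1 + m ^ 2) - √(r ^ 2 - y ^ 2) + y * m ∧
    (r * √(1 + m ^ 2) - √(r ^ 2 - y ^ 2) + y * m = 0 → m = - y / √(r ^ 2 - y ^ 2)) := by
  set q := √(r ^ 2 - y ^ 2) with hq
  have hq0 : 0 < q := Real.sqrt_pos.2 (by linarith)
  have hq2 : q ^ 2 = r ^ 2 - y ^ 2 := Real.sq_sqrt (by linarith)
  set s := √(1 + m ^ 2) with hs
  have hs0 : 0 < s := Real.sqrt_pos.2 (by positivity)
  have hs2 : s ^ 2 = 1 + m ^ 2 := Real.sq_sqrt (by positivity)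
  have key : (r * s) ^ 2 = (q - y * m) ^ 2 + (q * m + y) ^ 2 := by
    rw [mul_pow, hs2]; 
    have : r ^ 2 = q ^ 2 + y ^ 2 := by linarith
    rw [this]; ring
  constructor
  · have : q - y * m ≤ r * s := by
      exact le_of_abs_le (abs_le_of_sq_le_sq (by nlinarith [sq_nonneg (q * m + y)]) (mul_pos hr hs0).le)
    linarith
  · intro h
    have h1 : r * s = q - y * m := by linarith
    rw [h1] at key
    have : q * m + y = 0 := by
      have : (q * m + y) ^ 2 = 0 := by linarith
      exact pow_eq_zero_iff (two_ne_zero) |>.1 this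
    rw [eq_div_iff hq0.ne']; linarith

theorem defi_nonneg {r t y : ℝ} (htr : t < r) {g : ℝ → ℝ} (hy : y ∈ Icc (-t) t) :
    0 ≤ defi r g y := by
  have h1 := hy.1
  have h2 := hy.2
  exact (cs_aux (by linarith) (by nlinarith)).1

theorem sqrt_cont (r : ℝ) : Continuous fun y : ℝ => √(r ^ 2 - y ^ 2) := by fun_prop

theorem arc_int {t : ℝ} {g : ℝ → ℝ}
    (hg : AbsolutelyContinuousOnInterval g (-t) t) :
    IntervalIntegrable (fun y => √(1 + (deriv g y) ^ 2)) volume (-t) t := by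
  have h1 := hg.intervalIntegrable_deriv
  have h2 : IntervalIntegrable (fun y => 1 + |deriv g y|) volume (-t) t :=
    intervalIntegrable_const.add h1.abs
  refine h2.mono_fun ?_ ?_
  · have := measurable_deriv g
    exact (by fun_prop : Measurable fun y => √(1 + (deriv g y) ^ 2)).aestronglyMeasurable
  · refine Eventually.of_forall fun y => ?_
    beta_reduce
    rw [Real.norm_of_nonneg (Real.sqrt_nonneg _), Real.norm_of_nonneg (by positivity)]
    rw [Real.sqrt_le_left (by positivity)]
    nlinarith [abs_nonneg (deriv g y), sq_abs (deriv g y)]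

theorem defi_int {r t : ℝ} {g : ℝ → ℝ}
    (hg : AbsolutelyContinuousOnInterval g (-t) t) :
    IntervalIntegrable (defi r g) volume (-t) t := by
  have h1 := hg.intervalIntegrable_deriv
  unfold defi
  exact (((arc_int hg).const_mul r).sub ((sqrt_cont r).intervalIntegrable _ _)).add
    (h1.continuousOn_mul continuousOn_id)

theorem arc_eq {r t : ℝ} {g : ℝ → ℝ}
    (hg : AbsolutelyContinuousOnInterval g (-t) t) :
    r * ∫ y in (-t)..t, √(1 + (deriv g y) ^ 2) =
      (∫ y in (-t)..t, √(r ^ 2 - y ^ 2)) + (∫ y in (-t)..t, g y) - t * (g t + g (-t))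
        + ∫ y in (-t)..t, defi r g y := by
  have h1 := hg.intervalIntegrable_deriv
  have hid : AbsolutelyContinuousOnInterval (fun y : ℝ => y) (-t) t :=
    (LipschitzWith.id.lipschitzOnWith).absolutelyContinuousOnInterval
  have h2 := hid.integral_mul_deriv_eq_deriv_mul hg
  simp only [deriv_id'', one_mul] at h2
  have h3 : IntervalIntegrable (fun y => y * deriv g y) volume (-t) t :=
    h1.continuousOn_mul continuousOn_id
  unfold defi
  rw [intervalIntegral.integral_add (((arc_int hg).const_mul r).sub
    ((sqrt_cont r).intervalIntegrable _ _)) h3,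
    intervalIntegral.integral_sub ((arc_int hg).const_mul r)
    ((sqrt_cont r).intervalIntegrable _ _), h2, intervalIntegral.integral_const_mul]
  ring

theorem defi_zero {r t : ℝ} {g : ℝ → ℝ} (ht : 0 < t) (htr : t < r)
    (hg : AbsolutelyContinuousOnInterval g (-t) t)
    (h0 : ∫ y in (-t)..t, defi r g y = 0) :
    ∀ y ∈ Icc (-t) t, g y = g 0 - r + √(r ^ 2 - y ^ 2) := by
  have hae : ∀ᵐ y, y ∈ Ioc (-t) t → deriv g y = - y / √(r ^ 2 - y ^ 2) := by
    rw [intervalIntegral.integral_of_le (by linarith)] at h0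
    rw [setIntegral_eq_zero_iff_of_nonneg_ae] at h0
    · have := (ae_restrict_iff' measurableSet_Ioc).1 h0
      filter_upwards [this] with y hy hy2
      refine (cs_aux (r := r) (y := y) (by linarith) (by nlinarith [hy2.1, hy2.2])).2 (hy hy2)
    · refine (ae_restrict_iff' measurableSet_Ioc).2 (Eventually.of_forall fun y hy => ?_)
      exact defi_nonneg htr (Ioc_subset_Icc_self hy)
    · exact (intervalIntegrable_iff_integrableOn_Ioc_of_le (by linarith)).1 (defi_int hg)
  intro y hy
  have hsub : uIcc 0 y ⊆ Icc (-t) t := by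
    rw [← uIcc_of_le (by linarith : -t ≤ t)]
    apply uIcc_subset_uIcc <;> rw [uIcc_of_le (by linarith : -t ≤ t)]
    · exact ⟨by linarith, by linarith⟩
    · exact hy
  have h1 : ∫ u in (0:ℝ)..y, deriv g u = g y - g 0 :=
    (hg.mono (by rwa [uIcc_of_le (by linarith : -t ≤ t)])).integral_deriv_eq_sub
  have hpos : ∀ u ∈ uIcc 0 y, 0 < r ^ 2 - u ^ 2 := fun u hu => by
    have := hsub hu; nlinarith [this.1, this.2]
  have h2 : ∫ u in (0:ℝ)..y, - u / √(r ^ 2 - u ^ 2) = √(r ^ 2 - y ^ 2) - √(r ^ 2 - 0 ^ 2) := by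
    apply intervalIntegral.integral_eq_sub_of_hasDerivAt
    · intro u hu
      have := hpos u hu
      have h3 : HasDerivAt (fun u : ℝ => r ^ 2 - u ^ 2) (-(2 * u)) u := by
        have := (hasDerivAt_pow 2 u).const_sub (r ^ 2)
        simpa using this
      have h5 := h3.sqrt this.ne'
      rwa [show -(2 * u) = 2 * (-u) by ring, mul_div_mul_left _ _ two_ne_zero] at h5
    · apply ContinuousOn.intervalIntegrable
      apply ContinuousOn.div (by fun_prop) (by fun_prop)
      intro u hu
      exact (Real.sqrt_pos.2 (hpos u hu)).ne'
  have h3 : ∫ u in (0:ℝ)..y, deriv g u = ∫ u in (0:ℝ)..y, - u / √(r ^ 2 - u ^ 2) := by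
    apply intervalIntegral.integral_congr_ae
    have hne : ∀ᵐ u : ℝ, u ≠ -t := by simp [ae_iff]
    filter_upwards [hae, hne] with u hu hu2 hu3
    have := hsub (uIoc_subset_uIcc hu3)
    exact hu ⟨lt_of_le_of_ne this.1 (Ne.symm hu2), this.2⟩
  have h4 : √(r ^ 2 - 0 ^ 2) = r := by
    rw [show r ^ 2 - 0 ^ 2 = r ^ 2 by ring]; exact Real.sqrt_sq (by linarith)
  rw [h4] at h2
  linarith

theorem half_disk {r : ℝ} (hr : 0 < r) :
    ∫ y in (-r)..r, √(r ^ 2 - y ^ 2) = Real.pi * r ^ 2 / 2 := by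
  have h := intervalIntegral.integral_comp_mul_left (a := -1) (b := 1)
    (fun y : ℝ => √(r ^ 2 - y ^ 2)) hr.ne'
  have h2 : ∀ x : ℝ, √(r ^ 2 - (r * x) ^ 2) = r * √(1 - x ^ 2) := fun x => by
    rw [show r ^ 2 - (r * x) ^ 2 = r ^ 2 * (1 - x ^ 2) by ring, Real.sqrt_mul (by positivity),
      Real.sqrt_sq hr.le]
  simp only [h2] at h
  rw [intervalIntegral.integral_const_mul, integral_sqrt_one_sub_sq] at h
  simp only [mul_neg, mul_one, smul_eq_mul] at h
  field_simp at h
  linarith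

theorem prim_tendsto {r : ℝ} (hr : 0 < r) {φ : ℝ → ℝ} (hφ : IntervalIntegrable φ volume (-r) r) :
    Tendsto (fun t => ∫ y in (-t)..t, φ y) (𝓝[<] r) (𝓝 (∫ y in (-r)..r, φ y)) := by
  have h0 : (0:ℝ) ∈ uIcc (-r) r := by
    rw [uIcc_of_le (by linarith)]; exact ⟨by linarith, hr.le⟩
  have hc := intervalIntegral.continuousOn_primitive_interval' hφ h0
  have hm : ∀ᶠ t in 𝓝[<] r, t ∈ Ioo 0 r := Ioo_mem_nhdsLT hr
  have key : ∀ t ∈ Icc 0 r, ∫ y in (-t)..t, φ y = (∫ y in (0:ℝ)..t, φ y) - ∫ y in (0:ℝ)..(-t), φ y := by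
    intro t ht
    have hi : ∀ u ∈ Icc (-r) r, IntervalIntegrable φ volume 0 u := fun u hu => by
      apply hφ.mono_set
      apply uIcc_subset_uIcc h0
      rwa [uIcc_of_le (by linarith)]
    rw [intervalIntegral.integral_interval_sub_left (hi _ ⟨by linarith [ht.1], ht.2⟩)
      (hi _ ⟨by linarith [ht.2], by linarith [ht.1]⟩)]
  rw [key r ⟨hr.le, le_rfl⟩]
  have h1 : Tendsto (fun t => ∫ y in (0:ℝ)..t, φ y) (𝓝[<] r) (𝓝 (∫ y in (0:ℝ)..r, φ y)) := by
    refine (hc r (by simp)).tendsto.comp (tendsto_id.mono_left ?_) |>.congr fun t => rfl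
    refine le_inf nhdsWithin_le_nhds (le_principal_iff.2 ?_)
    filter_upwards [hm] with t ht
    rw [uIcc_of_le (by linarith)]; exact ⟨by linarith [ht.1], ht.2.le⟩
  have h2 : Tendsto (fun t => ∫ y in (0:ℝ)..(-t), φ y) (𝓝[<] r) (𝓝 (∫ y in (0:ℝ)..(-r), φ y)) := by
    refine (hc (-r) (by simp)).tendsto.comp (tendsto_nhdsWithin_iff.2 ⟨?_, ?_⟩)
    · exact (continuous_neg.tendsto r).mono_left nhdsWithin_le_nhds
    · filter_upwards [hm] with t ht
      rw [uIcc_of_le (by linarith)]; exact ⟨by linarith [ht.2], by linarith [ht.1]⟩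
  refine (h1.sub h2).congr' ?_
  filter_upwards [hm] with t ht
  exact (key t ⟨ht.1.le, ht.2.le⟩).symm

theorem defi_mono {r s t : ℝ} {g : ℝ → ℝ} (hs : 0 < s) (hst : s ≤ t) (htr : t < r)
    (hg : AbsolutelyContinuousOnInterval g (-t) t) :
    ∫ y in (-s)..s, defi r g y ≤ ∫ y in (-t)..t, defi r g y := by
  apply intervalIntegral.integral_mono_interval (by linarith) (by linarith) hst _ (defi_int hg)
  refine (ae_restrict_iff' measurableSet_Ioc).2 (Eventually.of_forall fun y hy => ?_)
  exact defi_nonneg htr (Ioc_subset_Icc_self hy)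

theorem analytic_main {r : ℝ} (hr : 0 < r) {g h : ℝ → ℝ} (hg : ConcaveOn ℝ (Icc (-r) r) g)
    (hh : ConcaveOn ℝ (Icc (-r) r) h) (ν : Measure ℝ) [IsFiniteMeasure ν]
    (hν : ∀ c d, -r < c → c ≤ d → d < r →
      ENNReal.ofReal (√((d - c) ^ 2 + (g d - g c) ^ 2) + √((d - c) ^ 2 + (h d - h c) ^ 2))
        ≤ ν (Icc c d)) (P A : ℝ)
    (hw : ∀ t ∈ Icc (-r) r, 0 ≤ g t + h t)
    (hP : ∀ t, 0 < t → t < r →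
      (ν (Ioo (-t) t)).toReal + (g t + h t) + (g (-t) + h (-t)) ≤ P)
    (hwint : IntervalIntegrable (fun y => g y + h y) volume (-r) r)
    (hA : A = ∫ y in (-r)..r, (g y + h y)) :
    Real.pi * r ^ 2 + A ≤ r * P ∧ (Real.pi * r ^ 2 + A = r * P → ∀ y ∈ Ioo (-r) r,
      g y = g 0 - r + √(r ^ 2 - y ^ 2) ∧ h y = h 0 - r + √(r ^ 2 - y ^ 2)) := by
  set F : ℝ → ℝ := fun t => ∫ y in (-t)..t, (2 * √(r ^ 2 - y ^ 2) + (g y + h y)) with hF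
  have hsq : ∀ a b, IntervalIntegrable (fun y : ℝ => 2 * √(r ^ 2 - y ^ 2)) volume a b := fun a b =>
    ((sqrt_cont r).intervalIntegrable a b).const_mul 2
  have hFr : F r = Real.pi * r ^ 2 + A := by
    simp only [hF]
    rw [intervalIntegral.integral_add (hsq _ _) hwint, intervalIntegral.integral_const_mul,
      half_disk hr, hA]
    ring
  have hFlim : Tendsto F (𝓝[<] r) (𝓝 (F r)) := prim_tendsto hr ((hsq _ _).add hwint)
  have step : ∀ t, 0 < t → t < r →
      F t + (∫ y in (-t)..t, defi r g y) + (∫ y in (-t)..t, defi r h y) ≤ r * P := by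
    intro t ht htr
    have ag := concave_ac hg ht htr
    have ah := concave_ac hh ht htr
    have h1 := length_lower ht htr ag ah ν hν
    have h2 : (∫ y in (-t)..t, √(1 + (deriv g y) ^ 2)) + (∫ y in (-t)..t, √(1 + (deriv h y) ^ 2))
        ≤ (ν (Ioo (-t) t)).toReal := by
      rw [← intervalIntegral.integral_add (arc_int ag) (arc_int ah),
        intervalIntegral.integral_of_le (by linarith), integral_Ioc_eq_integral_Ioo,
        integral_eq_lintegral_of_nonneg_ae]
      · exact ENNReal.toReal_mono (measure_ne_top _ _) h1
      · exact Eventually.of_forall fun y => by positivity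
      · have := measurable_deriv g
        have := measurable_deriv h
        exact (by fun_prop : Measurable fun y =>
          √(1 + (deriv g y) ^ 2) + √(1 + (deriv h y) ^ 2)).aestronglyMeasurable
    have e1 := arc_eq (r := r) ag
    have e2 := arc_eq (r := r) ah
    have h3 := hP t ht htr
    have ig : IntervalIntegrable g volume (-t) t := ag.continuousOn.intervalIntegrable
    have ih : IntervalIntegrable h volume (-t) t := ah.continuousOn.intervalIntegrable
    have hFt : F t = 2 * (∫ y in (-t)..t, √(r ^ 2 - y ^ 2)) +
        ((∫ y in (-t)..t, g y) + (∫ y in (-t)..t, h y)) := by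
      simp only [hF]
      rw [intervalIntegral.integral_add (hsq _ _) (ig.add ih),
        intervalIntegral.integral_const_mul, intervalIntegral.integral_add ig ih]
    have w1 := hw t ⟨by linarith, by linarith⟩
    have w2 := hw (-t) ⟨by linarith, by linarith⟩
    have h4 := mul_le_mul_of_nonneg_left h3 hr.le
    have h5 := mul_le_mul_of_nonneg_left h2 hr.le
    have h6 := mul_nonneg (by linarith : 0 ≤ r - t) (add_nonneg w1 w2)
    nlinarith
  have dnn : ∀ t, 0 < t → t < r → ∀ k, 0 ≤ ∫ y in (-t)..t, defi r k y := fun t ht htr k =>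
    intervalIntegral.integral_nonneg (by linarith) fun y hy => defi_nonneg htr hy
  have lim : ∀ s, 0 < s → s < r →
      F r + (∫ y in (-s)..s, defi r g y) + (∫ y in (-s)..s, defi r h y) ≤ r * P := by
    intro s hs hsr
    refine le_of_tendsto ((hFlim.add_const _).add_const _) ?_
    filter_upwards [Ioo_mem_nhdsLT hsr] with t ht
    have := step t (by linarith [ht.1]) ht.2
    have := defi_mono hs ht.1.le ht.2 (concave_ac hg (by linarith [ht.1]) ht.2)
    have := defi_mono hs ht.1.le ht.2 (concave_ac hh (by linarith [ht.1]) ht.2)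
    linarith
  rw [← hFr]
  constructor
  · have := lim (r / 2) (by linarith) (by linarith)
    have := dnn (r / 2) (by linarith) (by linarith) g
    have := dnn (r / 2) (by linarith) (by linarith) h
    linarith
  · intro heq y hy
    obtain ⟨t, ht1, ht2⟩ := exists_between (max_lt hr (abs_lt.2 hy))
    have ht0 : 0 < t := (le_max_left _ _).trans_lt ht1
    have hyt : y ∈ Icc (-t) t := abs_le.1 ((le_max_right _ _).trans ht1.le)
    have l := lim t ht0 ht2
    have d1 := dnn t ht0 ht2 g
    have d2 := dnn t ht0 ht2 h
    exact ⟨defi_zero ht0 ht2 (concave_ac hg ht0 ht2) (by linarith) y hyt,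
      defi_zero ht0 ht2 (concave_ac hh ht0 ht2) (by linarith) y hyt⟩

theorem vol_slice {S : Set (EuclideanSpace ℝ (Fin 2))} (hS : MeasurableSet S) (y0 : ℝ) :
    volume S = ∫⁻ y : ℝ, volume {x : ℝ | !₂[x, y0 + y] ∈ S} := by
  have e1 := EuclideanSpace.volume_preserving_symm_measurableEquiv_toLp (Fin 2)
  have e2 := volume_preserving_finTwoArrow ℝ
  have e3 := (e2.comp e1).symm (e := ((MeasurableEquiv.toLp 2 (Fin 2 → ℝ)).symm.trans
    MeasurableEquiv.finTwoArrow))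
  have h1 := e3.measure_preimage hS.nullMeasurableSet
  rw [← h1, Measure.volume_eq_prod, Measure.prod_apply_symm
    (e3.measurable hS), ← lintegral_add_left_eq_self _ y0]
  rfl

/-- explicit stadium -/
def stad (c0 c1 r s : ℝ) : Set (EuclideanSpace ℝ (Fin 2)) :=
  {p | (max (|p 0 - c0| - s) 0) ^ 2 + (p 1 - c1) ^ 2 ≤ r ^ 2}

theorem stad_eq {c0 c1 r s : ℝ} (hr : 0 ≤ r) (hs : 0 ≤ s) :
    stad c0 c1 r s = segment ℝ (!₂[c0, c1] - s • EuclideanSpace.single 0 1)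
      (!₂[c0, c1] + s • EuclideanSpace.single 0 1)
            + Metric.closedBall (0 : EuclideanSpace ℝ (Fin 2)) r := by
  ext p
  rw [Set.mem_add]
  constructor
  · intro hp
    simp only [stad, mem_ofPred_eq] at hp
    obtain ⟨q, hq1, hq2⟩ : ∃ q : ℝ, |q| ≤ s ∧ |p 0 - c0 - q| ≤ max (|p 0 - c0| - s) 0 := by
      rcases le_total (|p 0 - c0|) s with h | h
      · exact ⟨p 0 - c0, h, by simp⟩
      · rcases abs_cases (p 0 - c0) with ⟨h1, h2⟩ | ⟨h1, h2⟩
        · refine ⟨s, by rw [abs_of_nonneg hs], le_max_of_le_left ?_⟩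
          rw [abs_of_nonneg (by linarith)]; linarith
        · refine ⟨-s, by rw [abs_neg, abs_of_nonneg hs], le_max_of_le_left ?_⟩
          rw [abs_of_nonpos (by linarith)]; linarith
    refine ⟨!₂[c0 + q, c1], ?_, !₂[p 0 - c0 - q, p 1 - c1], ?_, ?_⟩
    · obtain ⟨h1, h2⟩ := abs_le.1 hq1
      rcases hs.eq_or_lt with h | h
      · have : q = 0 := by linarith
        subst h; subst this
        simp
      · refine ⟨(s - q) / (2 * s), (s + q) / (2 * s), by apply div_nonneg <;> linarith,
          by apply div_nonneg <;> linarith, by field_simp; ring, ?_⟩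
        ext i
        fin_cases i
        · simp; field_simp; ring
        · simp; field_simp; ring
    · rw [mem_closedBall_zero_iff, EuclideanSpace.norm_eq, Real.sqrt_le_left hr]
      simp only [Fin.sum_univ_two, Real.norm_eq_abs, sq_abs]
      refine le_trans ?_ hp
      simp
      have := pow_le_pow_left₀ (abs_nonneg _) hq2 2
      rwa [sq_abs] at this
    · ext i
      fin_cases i <;> simp
  · rintro ⟨q, ⟨a, b, ha, hb, hab, rfl⟩, v, hv, rfl⟩
    rw [mem_closedBall_zero_iff, EuclideanSpace.norm_eq, Real.sqrt_le_left hr] at hv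
    simp only [Fin.sum_univ_two, Real.norm_eq_abs, sq_abs] at hv
    simp only [stad, mem_ofPred_eq]
    have e0 : (a • (!₂[c0, c1] - s • EuclideanSpace.single 0 1) + b • (!₂[c0, c1] + s • EuclideanSpace.single 0 1) + v : EuclideanSpace ℝ (Fin 2)) 0 - c0 = (b - a) * s + v 0 := by
      have : a = 1 - b := by linarith
      subst this
      simp; ring
    have e1 : (a • (!₂[c0, c1] - s • EuclideanSpace.single 0 1) + b • (!₂[c0, c1] + s • EuclideanSpace.single 0 1) + v : EuclideanSpace ℝ (Fin 2)) 1 - c1 = v 1 := by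
      have : a = 1 - b := by linarith
      subst this
      simp; ring
    rw [e0, e1]
    have : max (|(b - a) * s + v 0| - s) 0 ≤ |v 0| := by
      apply max_le _ (abs_nonneg _)
      have h1 := abs_add_le ((b - a) * s) (v 0)
      have h2 : |(b - a) * s| ≤ s := by
        rw [abs_mul, abs_of_nonneg hs]
        have : |b - a| ≤ 1 := abs_le.2 ⟨by linarith, by linarith⟩
        nlinarith
      linarith
    have := pow_le_pow_left₀ (le_max_right _ _) this 2
    rw [sq_abs] at this
    linarith

theorem stad_compact {c0 c1 r s : ℝ} (hr : 0 ≤ r) (hs : 0 ≤ s) : IsCompact (stad c0 c1 r s) := by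
  rw [stad_eq hr hs]
  refine IsCompact.add ?_ (isCompact_closedBall _ _)
  rw [segment_eq_image]
  exact isCompact_Icc.image (by fun_prop)

theorem stad_convex {c0 c1 r s : ℝ} (hr : 0 ≤ r) (hs : 0 ≤ s) : Convex ℝ (stad c0 c1 r s) := by
  rw [stad_eq hr hs]
  exact (convex_segment _ _).add (convex_closedBall _ _)

theorem stad_interior {c0 c1 r s : ℝ} (hr : 0 < r) (hs : 0 ≤ s) :
    (interior (stad c0 c1 r s)).Nonempty := by
  refine ⟨!₂[c0, c1], ?_⟩
  rw [mem_interior]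
  refine ⟨{p | (max (|p 0 - c0| - s) 0) ^ 2 + (p 1 - c1) ^ 2 < r ^ 2}, ?_, ?_, ?_⟩
  · intro p hp
    exact le_of_lt (by simpa using hp)
  · exact isOpen_lt (by fun_prop) (by fun_prop)
  · simp [hs]; positivity

theorem stad_volume {c0 c1 r s : ℝ} (hr : 0 < r) (hs : 0 ≤ s) :
    ENNReal.ofReal (Real.pi * r ^ 2 + 4 * s * r) ≤ volume (stad c0 c1 r s) := by
  rw [vol_slice (stad_compact hr.le hs).isClosed.measurableSet c1]
  have hi : IntervalIntegrable (fun y : ℝ => 2 * s + 2 * √(r ^ 2 - y ^ 2)) volume (-r) r := by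
    apply Continuous.intervalIntegrable; fun_prop
  calc _ = ENNReal.ofReal (∫ y in (-r)..r, (2 * s + 2 * √(r ^ 2 - y ^ 2))) := by
        rw [intervalIntegral.integral_add (by simp)
          (((sqrt_cont r).intervalIntegrable _ _).const_mul 2),
          intervalIntegral.integral_const_mul 2 (fun y => √(r ^ 2 - y ^ 2)),
          half_disk hr]
        congr 1
        simp
        ring
    _ = ∫⁻ y in Ioc (-r) r, ENNReal.ofReal (2 * s + 2 * √(r ^ 2 - y ^ 2)) := by
        rw [intervalIntegral.integral_of_le (by linarith), ofReal_integral_eq_lintegral_ofReal]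
        · exact (intervalIntegrable_iff_integrableOn_Ioc_of_le (by linarith)).1 hi
        · exact Eventually.of_forall fun y => by positivity
    _ ≤ ∫⁻ y in Ioc (-r) r, volume {x : ℝ | !₂[x, c1 + y] ∈ stad c0 c1 r s} := by
        apply setLIntegral_mono' measurableSet_Ioc
        intro y hy
        have hy2 : 0 ≤ r ^ 2 - y ^ 2 := by nlinarith [hy.1, hy.2]
        have h1 := Real.sq_sqrt hy2
        have h0 := Real.sqrt_nonneg (r ^ 2 - y ^ 2)
        set q := √(r ^ 2 - y ^ 2)
        calc ENNReal.ofReal (2 * s + 2 * q) = volume (Icc (c0 - s - q) (c0 + s + q)) := by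
              rw [Real.volume_Icc]; congr 1; ring
          _ ≤ _ := by
              apply measure_mono
              intro x hx
              simp only [stad, mem_ofPred_eq]
              have : max (|x - c0| - s) 0 ≤ q := by
                apply max_le _ h0
                have : |x - c0| ≤ s + q := abs_le.2 ⟨by linarith [hx.1], by linarith [hx.2]⟩
                linarith
              have := pow_le_pow_left₀ (le_max_right _ _) this 2
              simp
              linarith
    _ ≤ _ := setLIntegral_le_lintegral _ _

theorem arc_haus {a b r k : ℝ} (hr : 0 ≤ r) (hk : k ^ 2 = 1) :
    μH[(1:ℝ)] ((fun θ : ℝ => (!₂[a + k * (r * Real.cos θ), b + r * Real.sin θ] :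
      EuclideanSpace ℝ (Fin 2))) '' Icc (-(Real.pi / 2)) (Real.pi / 2))
      ≤ ENNReal.ofReal (Real.pi * r) := by
  have hl : LipschitzWith r.toNNReal (fun θ : ℝ => (!₂[a + k * (r * Real.cos θ), b + r * Real.sin θ] :
      EuclideanSpace ℝ (Fin 2))) := by
    apply LipschitzWith.of_dist_le_mul
    intro x y
    rw [EuclideanSpace.dist_eq, Real.coe_toNNReal r hr, Real.sqrt_le_left (by positivity)]
    simp only [Fin.sum_univ_two, Real.dist_eq, sq_abs, mul_pow]
    simp
    have h1 := Real.one_sub_sq_div_two_le_cos (x := x - y)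
    rw [Real.cos_sub] at h1
    have h2 := Real.sin_sq_add_cos_sq x
    have h3 := Real.sin_sq_add_cos_sq y
    have : (k * (r * Real.cos x) - k * (r * Real.cos y)) ^ 2 + (r * Real.sin x - r * Real.sin y) ^ 2
      = r ^ 2 * (k ^ 2 * (Real.cos x - Real.cos y) ^ 2 + (Real.sin x - Real.sin y) ^ 2) := by ring
    rw [this, hk]
    apply mul_le_mul_of_nonneg_left _ (sq_nonneg r)
    nlinarith
  refine (hl.hausdorffMeasure_image_le zero_le_one _).trans ?_
  rw [hausdorffMeasure_real, Real.volume_Icc, ENNReal.rpow_one, mul_comm Real.pi,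
    ENNReal.ofReal_mul hr]
  rw [show Real.pi / 2 - -(Real.pi / 2) = Real.pi by ring]
  rfl

theorem arc_mem {a b r k : ℝ} (hr : 0 < r) (hk : k ^ 2 = 1) {p : EuclideanSpace ℝ (Fin 2)}
    (h1 : 0 ≤ k * (p 0 - a)) (h2 : (p 0 - a) ^ 2 + (p 1 - b) ^ 2 = r ^ 2) :
    p ∈ (fun θ : ℝ => (!₂[a + k * (r * Real.cos θ), b + r * Real.sin θ] :
      EuclideanSpace ℝ (Fin 2))) '' Icc (-(Real.pi / 2)) (Real.pi / 2) := by
  have hv : |p 1 - b| ≤ r := abs_le_of_sq_le_sq (by nlinarith [sq_nonneg (p 0 - a)]) hr.le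
  obtain ⟨v1, v2⟩ := abs_le.1 hv
  refine ⟨Real.arcsin ((p 1 - b) / r), Real.arcsin_mem_Icc _, ?_⟩
  have hc : r * Real.cos (Real.arcsin ((p 1 - b) / r)) = k * (p 0 - a) := by
    rw [Real.cos_arcsin]
    nth_rewrite 1 [← Real.sqrt_sq hr.le]
    rw [← Real.sqrt_mul (by positivity), ← Real.sqrt_sq h1]
    congr 1
    rw [mul_pow, hk]
    field_simp
    linarith
  have hsn : r * Real.sin (Real.arcsin ((p 1 - b) / r)) = p 1 - b := by
    rw [Real.sin_arcsin (by rw [le_div_iff₀ hr]; linarith) (by rw [div_le_iff₀ hr]; linarith)]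
    field_simp
  ext i
  fin_cases i
  · simp [hc]
    linear_combination (p 0 - a) * hk
  · simp [hsn]

theorem hseg {c0 s b : ℝ} :
    μH[(1:ℝ)] ((fun x : ℝ => (!₂[x, b] : EuclideanSpace ℝ (Fin 2))) '' Icc (c0 - s) (c0 + s))
      ≤ ENNReal.ofReal (2 * s) := by
  have hl : LipschitzWith 1 (fun x : ℝ => (!₂[x, b] : EuclideanSpace ℝ (Fin 2))) := by
    apply LipschitzWith.of_dist_le_mul
    intro x y
    rw [EuclideanSpace.dist_eq]
    simp [Fin.sum_univ_two, Real.sqrt_sq_eq_abs, Real.dist_eq]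
  refine (hl.hausdorffMeasure_image_le zero_le_one _).trans ?_
  rw [hausdorffMeasure_real, Real.volume_Icc, ENNReal.rpow_one]
  rw [ENNReal.coe_one, one_mul]
  apply ENNReal.ofReal_le_ofReal
  linarith

theorem stad_perim {c0 c1 r s : ℝ} (hr : 0 < r) (hs : 0 ≤ s) :
    μH[(1:ℝ)] (frontier (stad c0 c1 r s)) ≤ ENNReal.ofReal (2 * Real.pi * r + 4 * s) := by
  set A1 := (fun x : ℝ => (!₂[x, c1 + r] : EuclideanSpace ℝ (Fin 2))) '' Icc (c0 - s) (c0 + s)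
  set A2 := (fun x : ℝ => (!₂[x, c1 - r] : EuclideanSpace ℝ (Fin 2))) '' Icc (c0 - s) (c0 + s)
  set A3 := (fun θ : ℝ => (!₂[(c0 + s) + 1 * (r * Real.cos θ), c1 + r * Real.sin θ] :
      EuclideanSpace ℝ (Fin 2))) '' Icc (-(Real.pi / 2)) (Real.pi / 2)
  set A4 := (fun θ : ℝ => (!₂[(c0 - s) + (-1) * (r * Real.cos θ), c1 + r * Real.sin θ] :
      EuclideanSpace ℝ (Fin 2))) '' Icc (-(Real.pi / 2)) (Real.pi / 2)
  have hsub : frontier (stad c0 c1 r s) ⊆ (A1 ∪ A2) ∪ (A3 ∪ A4) := by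
    intro p hp
    have hp2 : (max (|p 0 - c0| - s) 0) ^ 2 + (p 1 - c1) ^ 2 = r ^ 2 := by
      have := frontier_le_subset_eq (f := fun p : EuclideanSpace ℝ (Fin 2) =>
        (max (|p 0 - c0| - s) 0) ^ 2 + (p 1 - c1) ^ 2) (g := fun _ => r ^ 2)
        (by fun_prop) (by fun_prop) hp
      simpa using this
    rcases le_total (|p 0 - c0|) s with h | h
    · left
      rw [max_eq_right (by linarith)] at hp2
      obtain ⟨h1, h2⟩ := abs_le.1 h
      have : (p 1 - c1 - r) * (p 1 - c1 + r) = 0 := by linarith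
      rcases mul_eq_zero.1 this with h3 | h3
      · left
        refine ⟨p 0, ⟨by linarith, by linarith⟩, ?_⟩
        ext i; fin_cases i
        · simp
        · simp; linarith
      · right
        refine ⟨p 0, ⟨by linarith, by linarith⟩, ?_⟩
        ext i; fin_cases i
        · simp
        · simp; linarith
    · right
      rw [max_eq_left (by linarith)] at hp2
      rcases abs_cases (p 0 - c0) with ⟨h1, h2⟩ | ⟨h1, h2⟩
      · left
        apply arc_mem hr (by norm_num) (by linarith)
        rw [← hp2, h1]; ring
      · right
        apply arc_mem hr (by norm_num) (by linarith)
        rw [← hp2, h1]; ring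
  calc _ ≤ μH[(1:ℝ)] ((A1 ∪ A2) ∪ (A3 ∪ A4)) := measure_mono hsub
    _ ≤ (μH[(1:ℝ)] A1 + μH[(1:ℝ)] A2) + (μH[(1:ℝ)] A3 + μH[(1:ℝ)] A4) :=
        (measure_union_le _ _).trans (add_le_add (measure_union_le _ _) (measure_union_le _ _))
    _ ≤ (ENNReal.ofReal (2 * s) + ENNReal.ofReal (2 * s)) +
        (ENNReal.ofReal (Real.pi * r) + ENNReal.ofReal (Real.pi * r)) := by
        gcongr
        · exact hseg
        · exact hseg
        · exact arc_haus hr.le (by norm_num)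
        · exact arc_haus hr.le (by norm_num)
    _ = _ := by
        have := Real.pi_pos
        rw [← ENNReal.ofReal_add (by positivity) (by positivity),
          ← ENNReal.ofReal_add (by positivity) (by positivity),
          ← ENNReal.ofReal_add (by positivity) (by positivity)]
        congr 1; ring

theorem inner_e2 (p : EuclideanSpace ℝ (Fin 2)) :
    ⟪p, (EuclideanSpace.single 1 1 : EuclideanSpace ℝ (Fin 2))⟫ = p 1 := by
  rw [EuclideanSpace.inner_single_right]; simp

theorem stad_breadth {c0 c1 r s : ℝ} (hr : 0 < r) (hs : 0 ≤ s) :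
    vbreadth (stad c0 c1 r s) ≤ 2 * r := by
  have hne : (stad c0 c1 r s).Nonempty := (stad_interior hr hs).mono interior_subset
  have hb : ∀ p ∈ stad c0 c1 r s, |p 1 - c1| ≤ r := fun p hp =>
    abs_le_of_sq_le_sq (by
      have : (max (|p 0 - c0| - s) 0) ^ 2 + (p 1 - c1) ^ 2 ≤ r ^ 2 := hp
      nlinarith [sq_nonneg (max (|p 0 - c0| - s) 0)]) hr.le
  have h1 : suppFn (stad c0 c1 r s) (EuclideanSpace.single 1 1) ≤ c1 + r := by
    apply csSup_le (hne.image _)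
    rintro _ ⟨p, hp, rfl⟩
    have := (abs_le.1 (hb p hp)).2
    simp only [inner_neg_right, inner_e2]
    linarith
  have h2 : suppFn (stad c0 c1 r s) (-(EuclideanSpace.single 1 1)) ≤ -c1 + r := by
    apply csSup_le (hne.image _)
    rintro _ ⟨p, hp, rfl⟩
    have := (abs_le.1 (hb p hp)).1
    simp only [inner_neg_right, inner_e2]
    linarith
  unfold vbreadth
  linarith

/-- `K` is a convex body whose vertical extent is exactly `[y0 - r, y0 + r]`. -/
structure Strip (K : Set (EuclideanSpace ℝ (Fin 2))) (y0 r : ℝ) : Prop where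
  cpt : IsCompact K
  cvx : Convex ℝ K
  int : (interior K).Nonempty
  hr : 0 < r
  bd : ∀ p ∈ K, |p 1 - y0| ≤ r
  top : ∃ p ∈ K, p 1 = y0 + r
  bot : ∃ p ∈ K, p 1 = y0 - r

/-- Right (`k = 1`) and left (`k = -1`) boundary function. -/
noncomputable def Gf (K : Set (EuclideanSpace ℝ (Fin 2))) (y0 k y : ℝ) : ℝ :=
  sSup {x : ℝ | (!₂[k * x, y0 + y] : EuclideanSpace ℝ (Fin 2)) ∈ K}

theorem eta2 (p : EuclideanSpace ℝ (Fin 2)) : (!₂[p 0, p 1] : EuclideanSpace ℝ (Fin 2)) = p := by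
  ext i; fin_cases i <;> simp

theorem cont2 (k a : ℝ) : Continuous fun x : ℝ => (!₂[k * x, a] : EuclideanSpace ℝ (Fin 2)) := by
  fun_prop

theorem mem_frontier_of_ray {K : Set (EuclideanSpace ℝ (Fin 2))} {p v : EuclideanSpace ℝ (Fin 2)}
    (hp : p ∈ K) (h : ∀ ε : ℝ, 0 < ε → p + ε • v ∉ K) : p ∈ frontier K := by
  refine ⟨subset_closure hp, fun hi => ?_⟩
  have hc : Tendsto (fun ε : ℝ => p + ε • v) (𝓝[>] 0) (𝓝 p) := by
    have : Continuous fun ε : ℝ => p + ε • v := by fun_prop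
    have := this.tendsto 0
    simp only [zero_smul, add_zero] at this
    exact this.mono_left nhdsWithin_le_nhds
  have h1 := hc (mem_interior_iff_mem_nhds.1 hi)
  have h2 : ∀ᶠ ε in 𝓝[>] (0:ℝ), p + ε • v ∈ K ∧ 0 < ε :=
    Filter.Eventually.and h1 self_mem_nhdsWithin
  obtain ⟨ε, h3, h4⟩ := h2.exists
  exact h ε h4 h3

theorem exists_frontier_ray {K : Set (EuclideanSpace ℝ (Fin 2))} (hK : IsCompact K)
    {p v : EuclideanSpace ℝ (Fin 2)} (hv : v ≠ 0)
    (hp : p ∈ K) : ∃ s : ℝ, 0 ≤ s ∧ p + s • v ∈ frontier K := by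
  have hv' : 0 < ‖v‖ := norm_pos_iff.2 hv
  set T := {s : ℝ | 0 ≤ s ∧ p + s • v ∈ K} with hT
  obtain ⟨R, hR⟩ := hK.isBounded.exists_norm_le
  have hTc : IsCompact T := by
    refine Metric.isCompact_of_isClosed_isBounded ?_ ?_
    · exact isClosed_Ici.inter (hK.isClosed.preimage (by fun_prop : Continuous fun s : ℝ => p + s • v))
    · refine (Metric.isBounded_Icc 0 (2 * R / ‖v‖)).subset ?_
      rintro s ⟨h1, h2⟩
      refine ⟨h1, ?_⟩
      rw [le_div_iff₀ hv']
      have := hR _ h2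
      have h3 := hR _ hp
      have h4 : ‖s • v‖ ≤ ‖p + s • v‖ + ‖p‖ := by
        have := norm_sub_le (p + s • v) p
        simpa using this
      rw [norm_smul, Real.norm_of_nonneg h1] at h4
      linarith
  obtain ⟨s, ⟨hs0, hs⟩, hmax⟩ := hTc.exists_isGreatest ⟨0, le_rfl, by simpa using hp⟩
  refine ⟨s, hs0, mem_frontier_of_ray (v := v) hs fun ε hε hmem => ?_⟩
  have : s + ε ≤ s := hmax ⟨by linarith, by rwa [add_smul, ← add_assoc]⟩
  linarith

namespace Strip

variable {K : Set (EuclideanSpace ℝ (Fin 2))} {y0 r : ℝ}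

theorem slice_nonempty (H : Strip K y0 r) {k y : ℝ} (hk : k ^ 2 = 1) (hy : y ∈ Icc (-r) r) :
    {x : ℝ | (!₂[k * x, y0 + y] : EuclideanSpace ℝ (Fin 2)) ∈ K}.Nonempty := by
  obtain ⟨p, hp, hp1⟩ := H.top
  obtain ⟨q, hq, hq1⟩ := H.bot
  have hr := H.hr
  have := H.cvx hp hq (a := (r + y) / (2 * r)) (b := (r - y) / (2 * r))
    (div_nonneg (by linarith [hy.1]) (by linarith)) (div_nonneg (by linarith [hy.2]) (by linarith))
    (by field_simp; ring)
  set z := ((r + y) / (2 * r)) • p + ((r - y) / (2 * r)) • q with hz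
  refine ⟨k * z 0, ?_⟩
  have hz1 : z 1 = y0 + y := by
    simp [hz, hp1, hq1]; field_simp; ring
  rw [mem_ofPred_eq, ← hz1, ← mul_assoc, ← sq, hk, one_mul, eta2]
  exact this

theorem slice_compact (H : Strip K y0 r) {k y : ℝ} (hk : k ^ 2 = 1) :
    IsCompact {x : ℝ | (!₂[k * x, y0 + y] : EuclideanSpace ℝ (Fin 2)) ∈ K} := by
  refine Metric.isCompact_of_isClosed_isBounded (H.cpt.isClosed.preimage (cont2 k _)) ?_
  obtain ⟨R, hR⟩ := H.cpt.isBounded.exists_norm_le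
  refine (Metric.isBounded_Icc (-R) R).subset fun x hx => ?_
  have h1 := (PiLp.norm_apply_le (!₂[k * x, y0 + y] : EuclideanSpace ℝ (Fin 2)) 0).trans (hR _ hx)
  have hk1 : |k| = 1 := by
    rw [← sq_abs] at hk
    nlinarith [abs_nonneg k]
  simp [hk1] at h1
  exact abs_le.1 h1

theorem G_mem (H : Strip K y0 r) {k y : ℝ} (hk : k ^ 2 = 1) (hy : y ∈ Icc (-r) r) :
    (!₂[k * Gf K y0 k y, y0 + y] : EuclideanSpace ℝ (Fin 2)) ∈ K :=
  (H.slice_compact hk).sSup_mem (H.slice_nonempty hk hy)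

theorem le_G (H : Strip K y0 r) {k y x : ℝ} (hk : k ^ 2 = 1)
    (hx : (!₂[k * x, y0 + y] : EuclideanSpace ℝ (Fin 2)) ∈ K) : x ≤ Gf K y0 k y :=
  le_csSup (H.slice_compact hk).bddAbove hx

theorem G_concave (H : Strip K y0 r) {k : ℝ} (hk : k ^ 2 = 1) :
    ConcaveOn ℝ (Icc (-r) r) (Gf K y0 k) := by
  refine ⟨convex_Icc _ _, fun x hx y hy a b ha hb hab => ?_⟩
  apply H.le_G hk
  have := H.cvx (H.G_mem hk hx) (H.G_mem hk hy) ha hb hab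
  convert this using 1
  have : a = 1 - b := by linarith
  subst this
  ext i
  fin_cases i <;> simp <;> ring

theorem mem_iff (H : Strip K y0 r) {x y : ℝ} (hy : y ∈ Icc (-r) r) :
    (!₂[x, y0 + y] : EuclideanSpace ℝ (Fin 2)) ∈ K ↔ x ∈ Icc (-Gf K y0 (-1) y) (Gf K y0 1 y) := by
  have k1 : (1:ℝ) ^ 2 = 1 := by norm_num
  have k2 : (-1:ℝ) ^ 2 = 1 := by norm_num
  constructor
  · intro h
    have h1 := H.le_G (x := x) k1 (by simpa using h)
    have h2 := H.le_G (x := -x) k2 (by simpa using h)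
    exact ⟨by linarith, h1⟩
  · intro hx
    have m1 := H.G_mem k1 hy
    have m2 := H.G_mem k2 hy
    rw [← segment_eq_Icc (hx.1.trans hx.2)] at hx
    obtain ⟨a, b, ha, hb, hab, rfl⟩ := hx
    have := H.cvx m2 m1 ha hb hab
    convert this using 1
    have : a = 1 - b := by linarith
    subst this
    ext i
    fin_cases i <;> simp ; ring

theorem w_nonneg (H : Strip K y0 r) {y : ℝ} (hy : y ∈ Icc (-r) r) :
    0 ≤ Gf K y0 1 y + Gf K y0 (-1) y := by
  have h := H.G_mem (k := 1) (by norm_num) hy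
  rw [one_mul, H.mem_iff hy] at h
  linarith [h.1]

theorem w_pos (H : Strip K y0 r) {y : ℝ} (hy : y ∈ Ioo (-r) r) :
    0 < Gf K y0 1 y + Gf K y0 (-1) y := by
  have hr := H.hr
  have k1 : (1:ℝ) ^ 2 = 1 := by norm_num
  have k2 : (-1:ℝ) ^ 2 = 1 := by norm_num
  have hc := (H.G_concave k1).add (H.G_concave k2)
  obtain ⟨p, hp⟩ := H.int
  have hpK := interior_subset hp
  set u := p 1 - y0 with hu
  have huI : u ∈ Icc (-r) r := abs_le.1 (H.bd p hpK)
  have hpe : (!₂[p 0, y0 + u] : EuclideanSpace ℝ (Fin 2)) = p := by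
    rw [hu, add_sub_cancel, eta2]
  have hwu : 0 < Gf K y0 1 u + Gf K y0 (-1) u := by
    by_contra hcon
    have hf : p ∈ frontier K := by
      refine mem_frontier_of_ray (v := EuclideanSpace.single 0 1) hpK fun ε hε hmem => ?_
      have e : p + ε • EuclideanSpace.single 0 1 = (!₂[p 0 + ε, y0 + u] : EuclideanSpace ℝ (Fin 2)) := by
        ext i; fin_cases i <;> simp [hu]
      rw [e, H.mem_iff huI] at hmem
      rw [← hpe, H.mem_iff huI] at hpK
      linarith [hmem.1, hmem.2, hpK.1, hpK.2]
    exact hf.2 hp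
  have main : ∀ v ∈ Icc (-r) r, ∀ a b : ℝ, 0 < a → 0 ≤ b → a + b = 1 → y = a * u + b * v →
      0 < Gf K y0 1 y + Gf K y0 (-1) y := by
    intro v hv a b ha hb hab he
    have := hc.2 huI hv ha.le hb hab
    simp only [smul_eq_mul, Pi.add_apply, ← he] at this
    have h1 := mul_pos ha hwu
    have h2 := mul_nonneg hb (H.w_nonneg hv)
    linarith
  rcases lt_trichotomy u y with h | h | h
  · have h0 : 0 < r - u := by linarith [hy.2]
    refine main r ⟨by linarith, le_rfl⟩ ((r - y) / (r - u)) ((y - u) / (r - u))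
      (div_pos (by linarith [hy.2]) h0) (div_nonneg (by linarith) h0.le) ?_ ?_
    · field_simp; ring
    · field_simp; ring
  · rwa [← h]
  · have h0 : 0 < u + r := by linarith [hy.1]
    refine main (-r) ⟨le_rfl, by linarith⟩ ((y + r) / (u + r)) ((u - y) / (u + r))
      (div_pos (by linarith [hy.1]) h0) (div_nonneg (by linarith) h0.le) ?_ ?_
    · field_simp; ring
    · field_simp; ring

theorem G_frontier (H : Strip K y0 r) {k y : ℝ} (hk : k ^ 2 = 1) (hy : y ∈ Icc (-r) r) :
    (!₂[k * Gf K y0 k y, y0 + y] : EuclideanSpace ℝ (Fin 2)) ∈ frontier K := by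
  refine mem_frontier_of_ray (v := k • EuclideanSpace.single 0 1) (H.G_mem hk hy)
    fun ε hε hmem => ?_
  have : Gf K y0 k y + ε ≤ Gf K y0 k y := by
    apply H.le_G hk
    convert hmem using 1
    ext i; fin_cases i <;> simp
    ring
  linarith

end Strip

theorem haus_curve {γ : ℝ → EuclideanSpace ℝ (Fin 2)} {c d : ℝ} (hcd : c ≤ d)
    (hγ : ContinuousOn γ (Icc c d)) :
    ENNReal.ofReal (dist (γ d) (γ c)) ≤ μH[(1:ℝ)] (γ '' Icc c d) := by
  have hl : LipschitzWith 1 (fun p : EuclideanSpace ℝ (Fin 2) => dist p (γ c)) :=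
    LipschitzWith.dist_left _
  have h1 := hl.hausdorffMeasure_image_le zero_le_one (γ '' Icc c d)
  rw [hausdorffMeasure_real, ENNReal.rpow_one, ENNReal.coe_one, one_mul] at h1
  refine le_trans ?_ h1
  have hpre : IsPreconnected ((fun p => dist p (γ c)) '' (γ '' Icc c d)) :=
    (isPreconnected_Icc.image _ hγ).image _ hl.continuous.continuousOn
  have hsub : Icc 0 (dist (γ d) (γ c)) ⊆ (fun p => dist p (γ c)) '' (γ '' Icc c d) := by
    apply hpre.Icc_subset
    · exact ⟨γ c, ⟨c, ⟨le_rfl, hcd⟩, rfl⟩, by simp⟩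
    · exact ⟨γ d, ⟨d, ⟨hcd, le_rfl⟩, rfl⟩, rfl⟩
  calc _ = volume (Icc 0 (dist (γ d) (γ c))) := by rw [Real.volume_Icc, sub_zero]
    _ ≤ _ := measure_mono hsub

theorem lip_coord : LipschitzWith 1 (fun p : EuclideanSpace ℝ (Fin 2) => p 0) := by
  apply LipschitzWith.of_dist_le_mul
  intro x y
  rw [NNReal.coe_one, one_mul, dist_eq_norm, dist_eq_norm]
  exact PiLp.norm_apply_le (x - y) 0

/-- boundary length measure pushed to the vertical axis -/
noncomputable def nuK (K : Set (EuclideanSpace ℝ (Fin 2))) (y0 : ℝ) : Measure ℝ :=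
  (μH[(1:ℝ)].restrict (frontier K)).map (fun p : EuclideanSpace ℝ (Fin 2) => p 1 - y0)

theorem nu_apply (K : Set (EuclideanSpace ℝ (Fin 2))) (y0 : ℝ) {B : Set ℝ} (hB : MeasurableSet B) :
    nuK K y0 B = μH[(1:ℝ)] ({p | p 1 - y0 ∈ B} ∩ frontier K) := by
  have hm : Measurable (fun p : EuclideanSpace ℝ (Fin 2) => p 1 - y0) := by fun_prop
  rw [nuK, Measure.map_apply hm hB, Measure.restrict_apply (hm hB)]
  rfl

namespace Strip

variable {K : Set (EuclideanSpace ℝ (Fin 2))} {y0 r : ℝ}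

theorem nu_chord (H : Strip K y0 r) (c d : ℝ) (hc : -r < c) (hcd : c ≤ d) (hd : d < r) :
    ENNReal.ofReal (√((d - c) ^ 2 + (Gf K y0 1 d - Gf K y0 1 c) ^ 2) +
      √((d - c) ^ 2 + (Gf K y0 (-1) d - Gf K y0 (-1) c) ^ 2)) ≤ nuK K y0 (Icc c d) := by
  have hsubI : Icc c d ⊆ Ioo (-r) r := fun x hx => ⟨by linarith [hx.1], by linarith [hx.2]⟩
  set γ : ℝ → ℝ → EuclideanSpace ℝ (Fin 2) := fun k y => !₂[k * Gf K y0 k y, y0 + y] with hγ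
  have hcont : ∀ k : ℝ, k ^ 2 = 1 → ContinuousOn (γ k) (Icc c d) := by
    intro k hk
    have h1 : ConcaveOn ℝ (Ioo (-r) r) (Gf K y0 k) :=
      (H.G_concave hk).subset Ioo_subset_Icc_self (convex_Ioo _ _)
    have h2 := (h1.continuousOn isOpen_Ioo).mono hsubI
    rw [hγ]
    refine (PiLp.continuous_toLp 2 _).comp_continuousOn ?_
    rw [continuousOn_pi]
    intro i
    fin_cases i
    · exact continuousOn_const.mul h2
    · exact (continuous_const.add continuous_id).continuousOn
  have hdist : ∀ k : ℝ, k ^ 2 = 1 → dist (γ k d) (γ k c) =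
      √((d - c) ^ 2 + (Gf K y0 k d - Gf K y0 k c) ^ 2) := by
    intro k hk
    rw [EuclideanSpace.dist_eq]
    congr 1
    simp [Fin.sum_univ_two, Real.dist_eq, hγ]
    linear_combination (Gf K y0 k d - Gf K y0 k c) ^ 2 * hk
  have hlow : ∀ k : ℝ, k ^ 2 = 1 →
      ENNReal.ofReal √((d - c) ^ 2 + (Gf K y0 k d - Gf K y0 k c) ^ 2) ≤
        μH[(1:ℝ)] (γ k '' Icc c d) := fun k hk => by
    rw [← hdist k hk]; exact haus_curve hcd (hcont k hk)
  have hfr : ∀ k : ℝ, k ^ 2 = 1 → γ k '' Icc c d ⊆ {p | p 1 - y0 ∈ Icc c d} ∩ frontier K := by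
    rintro k hk _ ⟨y, hy, rfl⟩
    refine ⟨by simpa only [hγ, mem_ofPred_eq, PiLp.toLp_apply, Matrix.cons_val_one, Matrix.cons_val_zero, Matrix.cons_val_fin_one, add_sub_cancel_left] using hy, H.G_frontier hk (Ioo_subset_Icc_self (hsubI hy))⟩
  have k1 : (1:ℝ) ^ 2 = 1 := by norm_num
  have k2 : (-1:ℝ) ^ 2 = 1 := by norm_num
  have hdisj : Disjoint (γ 1 '' Icc c d) (γ (-1) '' Icc c d) := by
    rw [Set.disjoint_left]
    rintro _ ⟨y, hy, rfl⟩ ⟨z, hz, he⟩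
    have e0 := congrArg (fun p : EuclideanSpace ℝ (Fin 2) => p 0) he
    have e1 := congrArg (fun p : EuclideanSpace ℝ (Fin 2) => p 1) he
    simp [hγ] at e0 e1
    subst e1
    linarith [H.w_pos (hsubI hy)]
  rw [nu_apply _ _ measurableSet_Icc,
    ENNReal.ofReal_add (Real.sqrt_nonneg _) (Real.sqrt_nonneg _)]
  calc _ ≤ μH[(1:ℝ)] (γ 1 '' Icc c d) + μH[(1:ℝ)] (γ (-1) '' Icc c d) :=
        add_le_add (hlow 1 k1) (hlow (-1) k2)
    _ = μH[(1:ℝ)] (γ 1 '' Icc c d ∪ γ (-1) '' Icc c d) :=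
        (measure_union hdisj (isCompact_Icc.image_of_continuousOn
          (hcont _ k2)).isClosed.measurableSet).symm
    _ ≤ _ := measure_mono (union_subset (hfr 1 k1) (hfr (-1) k2))

theorem nu_cap (H : Strip K y0 r) {k t : ℝ} (hk : k ^ 2 = 1) (ht : t ∈ Icc (-r) r) :
    ENNReal.ofReal (Gf K y0 1 t + Gf K y0 (-1) t) ≤ nuK K y0 {y | 0 ≤ k * (y - t)} := by
  have hB : MeasurableSet {y : ℝ | 0 ≤ k * (y - t)} :=
    (isClosed_le continuous_const (by fun_prop)).measurableSet
  rw [nu_apply _ _ hB]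
  have h1 := lip_coord.hausdorffMeasure_image_le zero_le_one
    ({p | p 1 - y0 ∈ {y : ℝ | 0 ≤ k * (y - t)}} ∩ frontier K)
  rw [hausdorffMeasure_real, ENNReal.rpow_one, ENNReal.coe_one, one_mul] at h1
  refine le_trans ?_ h1
  calc _ = volume (Icc (-Gf K y0 (-1) t) (Gf K y0 1 t)) := by
        rw [Real.volume_Icc, sub_neg_eq_add]
    _ ≤ _ := by
        apply measure_mono
        intro x hx
        have hm := (H.mem_iff ht).2 hx
        have hv : (k • EuclideanSpace.single 1 1 : EuclideanSpace ℝ (Fin 2)) ≠ 0 := by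
          intro h0
          have := congrArg (fun p : EuclideanSpace ℝ (Fin 2) => p 1) h0
          simp at this
          simp [this] at hk
        obtain ⟨s, hs, hf⟩ := exists_frontier_ray H.cpt hv hm
        refine ⟨_, ⟨?_, hf⟩, ?_⟩
        · simp
          have : k * (y0 + t + s * k - y0 - t) = s := by linear_combination s * hk
          rw [this]; exact hs
        · simp

theorem nu_total (H : Strip K y0 r) (hfin : μH[(1:ℝ)] (frontier K) ≠ ⊤) {t : ℝ} (ht0 : 0 < t)
    (htr : t < r) :
    (nuK K y0 (Ioo (-t) t)).toReal + (Gf K y0 1 t + Gf K y0 (-1) t)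
      + (Gf K y0 1 (-t) + Gf K y0 (-1) (-t)) ≤ (μH[(1:ℝ)] (frontier K)).toReal := by
  have e : nuK K y0 univ = μH[(1:ℝ)] (frontier K) := by
    rw [nu_apply _ _ MeasurableSet.univ]; simp
  have hI1 : t ∈ Icc (-r) r := ⟨by linarith, htr.le⟩
  have hI2 : -t ∈ Icc (-r) r := ⟨by linarith, by linarith⟩
  have c1 := H.nu_cap (k := 1) (by norm_num) hI1
  have c2 := H.nu_cap (k := -1) (by norm_num) hI2
  have s1 : {y : ℝ | 0 ≤ 1 * (y - t)} = Ici t := by ext y; simp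
  have s2 : {y : ℝ | 0 ≤ -1 * (y - -t)} = Iic (-t) := by
    ext y; simp only [mem_ofPred_eq, mem_Iic]; constructor <;> intro h <;> linarith
  rw [s1] at c1
  rw [s2] at c2
  have d1 : Disjoint (Ioo (-t) t) (Ici t) := by
    rw [Set.disjoint_left]; intro y hy hy2; exact absurd hy.2 (not_lt.2 hy2)
  have d2 : Disjoint (Ioo (-t) t ∪ Ici t) (Iic (-t)) := by
    rw [Set.disjoint_left]; rintro y (hy | hy) hy2
    · exact absurd hy.1 (not_lt.2 hy2)
    · have h1 : t ≤ y := hy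
      have h2 : y ≤ -t := hy2
      linarith
  have tot : nuK K y0 (Ioo (-t) t) + ENNReal.ofReal (Gf K y0 1 t + Gf K y0 (-1) t)
      + ENNReal.ofReal (Gf K y0 1 (-t) + Gf K y0 (-1) (-t)) ≤ μH[(1:ℝ)] (frontier K) := by
    calc _ ≤ nuK K y0 (Ioo (-t) t) + nuK K y0 (Ici t) + nuK K y0 (Iic (-t)) := by gcongr
      _ = nuK K y0 ((Ioo (-t) t ∪ Ici t) ∪ Iic (-t)) := by
          rw [measure_union d2 measurableSet_Iic, measure_union d1 measurableSet_Ici]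
      _ ≤ _ := by rw [← e]; exact measure_mono (subset_univ _)
  have hn : nuK K y0 (Ioo (-t) t) ≠ ⊤ :=
    ne_top_of_le_ne_top hfin (by rw [← e]; exact measure_mono (subset_univ _))
  have := ENNReal.toReal_mono hfin tot
  rwa [ENNReal.toReal_add (by simp [hn]) (by simp), ENNReal.toReal_add hn (by simp),
    ENNReal.toReal_ofReal (H.w_nonneg hI1), ENNReal.toReal_ofReal (H.w_nonneg hI2)] at this

theorem w_int (H : Strip K y0 r) :
    IntegrableOn (fun y => Gf K y0 1 y + Gf K y0 (-1) y) (Ioo (-r) r) := by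
  obtain ⟨R, hR⟩ := H.cpt.isBounded.exists_norm_le
  have hb : ∀ k : ℝ, k ^ 2 = 1 → ∀ y ∈ Icc (-r) r, Gf K y0 k y ≤ R := by
    intro k hk y hy
    have h1 := (PiLp.norm_apply_le _ 0).trans (hR _ (H.G_mem hk hy))
    have hk1 : |k| = 1 := by
      rw [← sq_abs] at hk
      nlinarith [abs_nonneg k]
    simp [hk1] at h1
    exact (abs_le.1 h1).2
  have k1 : (1:ℝ) ^ 2 = 1 := by norm_num
  have k2 : (-1:ℝ) ^ 2 = 1 := by norm_num
  have hc : ∀ k : ℝ, k ^ 2 = 1 → ContinuousOn (Gf K y0 k) (Ioo (-r) r) := fun k hk =>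
    ((H.G_concave hk).subset Ioo_subset_Icc_self (convex_Ioo _ _)).continuousOn isOpen_Ioo
  refine Integrable.of_bound
    (((hc _ k1).add (hc _ k2)).aestronglyMeasurable measurableSet_Ioo) (R + R) ?_
  refine (ae_restrict_iff' measurableSet_Ioo).2 (Eventually.of_forall fun y hy => ?_)
  have hy' := Ioo_subset_Icc_self hy
  rw [Real.norm_of_nonneg (H.w_nonneg hy')]
  linarith [hb 1 k1 y hy', hb (-1) k2 y hy']

theorem area (H : Strip K y0 r) :
    (volume K).toReal = ∫ y in (-r)..r, (Gf K y0 1 y + Gf K y0 (-1) y) := by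
  have hr := H.hr
  rw [intervalIntegral.integral_of_le (by linarith), integral_Ioc_eq_integral_Ioo,
    integral_eq_lintegral_of_nonneg_ae]
  · congr 1
    rw [vol_slice H.cpt.isClosed.measurableSet y0, ← setLIntegral_congr Ioo_ae_eq_Icc.symm,
      ← lintegral_indicator measurableSet_Icc]
    apply lintegral_congr
    intro y
    by_cases hy : y ∈ Icc (-r) r
    · rw [indicator_of_mem hy]
      have : {x : ℝ | (!₂[x, y0 + y] : EuclideanSpace ℝ (Fin 2)) ∈ K} =
          Icc (-Gf K y0 (-1) y) (Gf K y0 1 y) := by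
        ext x; exact H.mem_iff hy
      rw [this, Real.volume_Icc, sub_neg_eq_add]
    · rw [indicator_of_notMem hy]
      have : {x : ℝ | (!₂[x, y0 + y] : EuclideanSpace ℝ (Fin 2)) ∈ K} = ∅ := by
        rw [eq_empty_iff_forall_notMem]
        intro x hx
        apply hy
        have := H.bd _ hx
        simpa using abs_le.1 this
      rw [this, measure_empty]
  · refine (ae_restrict_iff' measurableSet_Ioo).2 (Eventually.of_forall fun y hy => ?_)
    exact H.w_nonneg (Ioo_subset_Icc_self hy)
  · exact H.w_int.aestronglyMeasurable

end Strip

theorem slab_subset {S T : Set (EuclideanSpace ℝ (Fin 2))} {y0 r : ℝ} (hS : Convex ℝ S)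
    (hT : IsClosed T) (hb : ∀ p ∈ S, |p 1 - y0| ≤ r) (hne : ∃ p ∈ S, |p 1 - y0| < r)
    (h : ∀ p ∈ S, |p 1 - y0| < r → p ∈ T) : S ⊆ T := by
  intro q hq
  obtain ⟨p, hp, hpr⟩ := hne
  have hc : Tendsto (fun ε : ℝ => (1 - ε) • q + ε • p) (𝓝[>] 0) (𝓝 q) := by
    have : Continuous fun ε : ℝ => (1 - ε) • q + ε • p := by fun_prop
    have := this.tendsto 0
    simp only [zero_smul, add_zero, sub_zero, one_smul] at this
    exact this.mono_left nhdsWithin_le_nhds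
  refine hT.mem_of_tendsto hc ?_
  filter_upwards [Ioo_mem_nhdsGT (zero_lt_one (α := ℝ))] with ε hε
  refine h _ (hS hq hp (by linarith [hε.2]) hε.1.le (by ring)) ?_
  have e : ((1 - ε) • q + ε • p : EuclideanSpace ℝ (Fin 2)) 1 - y0 =
      (1 - ε) * (q 1 - y0) + ε * (p 1 - y0) := by simp; ring
  rw [e]
  have h1 := abs_le.1 (hb q hq)
  have h2 := abs_lt.1 hpr
  rw [abs_lt]
  constructor <;> nlinarith [hε.1, hε.2]

theorem stad_mem_iff {c0 y0 r s x y : ℝ} (hr : 0 < r) (hy : |y| < r) :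
    (!₂[x, y0 + y] : EuclideanSpace ℝ (Fin 2)) ∈ stad c0 y0 r s ↔
      |x - c0| ≤ s + √(r ^ 2 - y ^ 2) := by
  have hy2 : 0 < r ^ 2 - y ^ 2 := by
    have := sq_lt_sq' (abs_lt.1 hy).1 (abs_lt.1 hy).2
    linarith
  have h1 := Real.sq_sqrt hy2.le
  have h0 := Real.sqrt_pos.2 hy2
  set q := √(r ^ 2 - y ^ 2)
  change (max (|x - c0| - s) 0) ^ 2 + (y0 + y - y0) ^ 2 ≤ r ^ 2 ↔ _
  rw [add_sub_cancel_left]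
  constructor
  · intro h
    have : max (|x - c0| - s) 0 ≤ q :=
      le_of_abs_le (abs_le_of_sq_le_sq (by linarith) h0.le)
    linarith [le_max_left (|x - c0| - s) 0]
  · intro h
    have : max (|x - c0| - s) 0 ≤ q := max_le (by linarith) h0.le
    have := pow_le_pow_left₀ (le_max_right _ _) this 2
    linarith

theorem key_thm {K : Set (EuclideanSpace ℝ (Fin 2))} {y0 r : ℝ} (H : Strip K y0 r)
    (hfin : μH[(1:ℝ)] (frontier K) ≠ ⊤) :
    Real.pi * r ^ 2 + (volume K).toReal ≤ r * (μH[(1:ℝ)] (frontier K)).toReal ∧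
    (Real.pi * r ^ 2 + (volume K).toReal = r * (μH[(1:ℝ)] (frontier K)).toReal →
      ∃ c0 s, 0 ≤ s ∧ K = stad c0 y0 r s) := by
  have hr := H.hr
  have k1 : (1:ℝ) ^ 2 = 1 := by norm_num
  have k2 : (-1:ℝ) ^ 2 = 1 := by norm_num
  have : IsFiniteMeasure (nuK K y0) := ⟨by
    rw [nu_apply _ _ MeasurableSet.univ]
    simpa using hfin.lt_top⟩
  have hwint : IntervalIntegrable (fun y => Gf K y0 1 y + Gf K y0 (-1) y) volume (-r) r := by
    rw [intervalIntegrable_iff_integrableOn_Ioo_of_le (by linarith)]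
    exact H.w_int
  obtain ⟨m1, m2⟩ := analytic_main hr (H.G_concave k1) (H.G_concave k2) (nuK K y0) H.nu_chord
    (μH[(1:ℝ)] (frontier K)).toReal (volume K).toReal (fun t ht => H.w_nonneg ht)
    (fun t ht htr => H.nu_total hfin ht htr) hwint H.area
  refine ⟨m1, fun heq => ?_⟩
  have m3 := m2 heq
  set α := Gf K y0 1 0 - r with hα
  set β := Gf K y0 (-1) 0 - r with hβ
  have hs : 0 ≤ α + β := by
    have ht : Tendsto (fun y : ℝ => α + β + 2 * √(r ^ 2 - y ^ 2)) (𝓝[<] r) (𝓝 (α + β)) := by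
      have : Continuous fun y : ℝ => α + β + 2 * √(r ^ 2 - y ^ 2) := by fun_prop
      have := this.tendsto r
      simp only [sub_self, Real.sqrt_zero, mul_zero, add_zero] at this
      exact this.mono_left nhdsWithin_le_nhds
    refine ge_of_tendsto ht ?_
    filter_upwards [Ioo_mem_nhdsLT hr] with y hy
    have hy' : y ∈ Ioo (-r) r := ⟨by linarith [hy.1], hy.2⟩
    have := H.w_pos hy'
    obtain ⟨a, b⟩ := m3 y hy'
    linarith
  have hiff : ∀ p : EuclideanSpace ℝ (Fin 2), |p 1 - y0| < r →
      (p ∈ K ↔ p ∈ stad ((α - β) / 2) y0 r ((α + β) / 2)) := by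
    intro p hp
    set y := p 1 - y0 with hy
    have hpe : (!₂[p 0, y0 + y] : EuclideanSpace ℝ (Fin 2)) = p := by
      rw [hy, add_sub_cancel, eta2]
    obtain ⟨a, b⟩ := m3 y (abs_lt.1 hp)
    rw [← hpe, H.mem_iff (Ioo_subset_Icc_self (abs_lt.1 hp)), stad_mem_iff hr hp, a, b, abs_le,
      mem_Icc]
    constructor
    · rintro ⟨h1, h2⟩; constructor <;> linarith
    · rintro ⟨h1, h2⟩; constructor <;> linarith
  have hs2 : 0 ≤ (α + β) / 2 := by linarith
  have hsb : ∀ p ∈ stad ((α - β) / 2) y0 r ((α + β) / 2), |p 1 - y0| ≤ r := fun p hp =>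
    abs_le_of_sq_le_sq (by
      have : (max (|p 0 - (α - β) / 2| - (α + β) / 2) 0) ^ 2 + (p 1 - y0) ^ 2 ≤ r ^ 2 := hp
      nlinarith [sq_nonneg (max (|p 0 - (α - β) / 2| - (α + β) / 2) 0)]) hr.le
  have h0r : |(0:ℝ)| < r := by simpa using hr
  have p0 : (!₂[(α - β) / 2, y0 + 0] : EuclideanSpace ℝ (Fin 2)) ∈
      stad ((α - β) / 2) y0 r ((α + β) / 2) := by
    rw [stad_mem_iff hr h0r]
    simp only [sub_self, abs_zero]
    positivity
  have p01 : |(!₂[(α - β) / 2, y0 + 0] : EuclideanSpace ℝ (Fin 2)) 1 - y0| < r := by simpa using hr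
  refine ⟨(α - β) / 2, (α + β) / 2, hs2, Subset.antisymm ?_ ?_⟩
  · exact slab_subset H.cvx (stad_compact hr.le hs2).isClosed H.bd
      ⟨_, (hiff _ p01).2 p0, p01⟩ fun p hp hpr => (hiff p hpr).1 hp
  · exact slab_subset (stad_convex hr.le hs2) H.cpt.isClosed hsb ⟨_, p0, p01⟩
      fun p hp hpr => (hiff p hpr).2 hp

theorem exists_strip {K : Set (EuclideanSpace ℝ (Fin 2))}
    (hKcp : IsCompact K) (hKcv : Convex ℝ K) (hKint : (interior K).Nonempty) :
    ∃ y0 r, Strip K y0 r ∧ vbreadth K = 2 * r := by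
  have hne : K.Nonempty := hKint.mono interior_subset
  have hc : ContinuousOn (fun p : EuclideanSpace ℝ (Fin 2) => p 1) K := by fun_prop
  obtain ⟨p, hp, hmax⟩ := hKcp.exists_isMaxOn hne hc
  obtain ⟨q, hq, hmin⟩ := hKcp.exists_isMinOn hne hc
  have hmax' : ∀ z ∈ K, z 1 ≤ p 1 := fun z hz => hmax hz
  have hmin' : ∀ z ∈ K, q 1 ≤ z 1 := fun z hz => hmin hz
  have hlt : q 1 < p 1 := by
    by_contra hcon
    obtain ⟨z, hz⟩ := hKint
    have hzK := interior_subset hz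
    have hf : z ∈ frontier K := by
      refine mem_frontier_of_ray (v := EuclideanSpace.single 1 1) hzK fun ε hε hmem => ?_
      have := hmax' _ hmem
      simp at this
      have := hmin' _ hzK
      linarith
    exact hf.2 hz
  have s1 : suppFn K (EuclideanSpace.single 1 1) = p 1 := by
    apply IsGreatest.csSup_eq
    refine ⟨⟨p, hp, inner_e2 p⟩, ?_⟩
    rintro _ ⟨z, hz, rfl⟩
    simp only [inner_e2]
    exact hmax' z hz
  have s2 : suppFn K (-(EuclideanSpace.single 1 1)) = - q 1 := by
    apply IsGreatest.csSup_eq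
    refine ⟨⟨q, hq, by simp only [inner_neg_right, inner_e2]⟩, ?_⟩
    rintro _ ⟨z, hz, rfl⟩
    simp only [inner_neg_right, inner_e2]
    linarith [hmin' z hz]
  refine ⟨(p 1 + q 1) / 2, (p 1 - q 1) / 2, ⟨hKcp, hKcv, hKint, by linarith, ?_, ?_, ?_⟩, ?_⟩
  · intro z hz
    rw [abs_le]
    constructor <;> linarith [hmin' z hz, hmax' z hz]
  · exact ⟨p, hp, by ring⟩
  · exact ⟨q, hq, by ring⟩
  · rw [vbreadth, s1, s2]; ring

/-- Competitor: a stadium of the same area, no larger breadth and perimeter at most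
`π r + A / r`. -/
theorem exists_stad {A r : ℝ} (hA : 0 < A) (hr : 0 < r) :
    ∃ ρ s, 0 < ρ ∧ 0 ≤ s ∧ A = Real.pi * ρ ^ 2 + 4 * s * ρ ∧ ρ ≤ r ∧
      r * (2 * Real.pi * ρ + 4 * s) ≤ Real.pi * r ^ 2 + A := by
  have hpi := Real.pi_pos
  rcases le_total A (Real.pi * r ^ 2) with h | h
  · have h1 : (√(A / Real.pi)) ^ 2 = A / Real.pi := Real.sq_sqrt (by positivity)
    have h2 : A = Real.pi * (√(A / Real.pi)) ^ 2 := by rw [h1]; field_simp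
    have h3 : 0 < √(A / Real.pi) := Real.sqrt_pos.2 (by positivity)
    set ρ := √(A / Real.pi)
    refine ⟨ρ, 0, h3, le_rfl, by linarith, ?_, ?_⟩
    · rw [h2] at h
      have := le_of_mul_le_mul_left h hpi
      exact le_of_abs_le (abs_le_of_sq_le_sq this hr.le)
    · nlinarith [mul_nonneg hpi.le (sq_nonneg (r - ρ))]
  · refine ⟨r, (A - Real.pi * r ^ 2) / (4 * r), hr, div_nonneg (by linarith) (by linarith),
      by field_simp; ring, le_rfl, ?_⟩
    have : r * (4 * ((A - Real.pi * r ^ 2) / (4 * r))) = A - Real.pi * r ^ 2 := by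
      field_simp
    nlinarith


/-- Planar Leidenfrost problem: a convex body in `ℝ²` that is Pareto-optimal for minimizing the
pair (perimeter, vertical breadth) among convex bodies of at least the same area is a stadium,
i.e. the Minkowski sum of a horizontal segment and a closed disk. -/
theorem planar_leidenfrost
    (K : Set (EuclideanSpace ℝ (Fin 2)))
    (hKcp : IsCompact K) (hKcv : Convex ℝ K) (hKint : (interior K).Nonempty)
    (hpareto : ¬ ∃ L : Set (EuclideanSpace ℝ (Fin 2)),
      IsCompact L ∧ Convex ℝ L ∧ (interior L).Nonempty ∧
      volume K ≤ volume L ∧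
      μH[(1 : ℝ)] (frontier L) ≤ μH[(1 : ℝ)] (frontier K) ∧
      vbreadth L ≤ vbreadth K ∧
      (μH[(1 : ℝ)] (frontier L) < μH[(1 : ℝ)] (frontier K) ∨ vbreadth L < vbreadth K)) :
    ∃ (c : EuclideanSpace ℝ (Fin 2)) (r s : ℝ), 0 < r ∧ 0 ≤ s ∧
      K = segment ℝ (c - s • EuclideanSpace.single 0 1) (c + s • EuclideanSpace.single 0 1)
            + Metric.closedBall (0 : EuclideanSpace ℝ (Fin 2)) r := by
  obtain ⟨y0, r, H, hbr⟩ := exists_strip hKcp hKcv hKint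
  have hr := H.hr
  have hpi := Real.pi_pos
  have hvol : volume K ≠ ⊤ := hKcp.measure_lt_top.ne
  have hA : 0 < (volume K).toReal :=
    ENNReal.toReal_pos (Measure.measure_pos_of_nonempty_interior volume hKint).ne' hvol
  set A := (volume K).toReal with hAdef
  obtain ⟨ρ, s, hρ, hs, hAeq, hρr, hper⟩ := exists_stad hA hr
  have notlt : ¬ ENNReal.ofReal (2 * Real.pi * ρ + 4 * s) < μH[(1:ℝ)] (frontier K) := by
    intro hlt
    have hlt2 := (stad_perim (c0 := 0) (c1 := 0) hρ hs).trans_lt hlt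
    refine hpareto ⟨stad 0 0 ρ s, stad_compact hρ.le hs, stad_convex hρ.le hs,
      stad_interior hρ hs, ?_, hlt2.le, ?_, Or.inl hlt2⟩
    · refine le_trans ?_ (stad_volume hρ hs)
      rw [← hAeq, hAdef, ENNReal.ofReal_toReal hvol]
    · rw [hbr]
      exact (stad_breadth hρ hs).trans (by linarith)
  have hfin : μH[(1:ℝ)] (frontier K) ≠ ⊤ := by
    intro h
    rw [h] at notlt
    exact notlt ENNReal.ofReal_lt_top
  obtain ⟨h1, h2⟩ := key_thm H hfin
  have h3 : (μH[(1:ℝ)] (frontier K)).toReal ≤ 2 * Real.pi * ρ + 4 * s :=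
    ENNReal.toReal_le_of_le_ofReal (by positivity) (not_lt.1 notlt)
  have h4 := mul_le_mul_of_nonneg_left h3 hr.le
  obtain ⟨c0, s', hs', hK⟩ := h2 (by linarith)
  exact ⟨!₂[c0, y0], r, s', hr, hs', by rw [← stad_eq hr.le hs']; exact hK⟩
end
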